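/- arXiv:0808.2942 — 2 statements merged into one kernel-verified Lean document; each statement's English description precedes it below -/
import Mathlib

section
/- Approximate amenability of self-induced Banach algebras is not a Morita invariant: if G is an amenable discrete group, I is a finite nonempty set, and J is an infinite set, then ℓ¹(B(I,G)) is approximately amenable, ℓ¹(B(J,G)) is not approximately amenable, yet ℓ¹(B(I,G)) and ℓ¹(B(J,G)) are Morita equivalent self-induced Banach algebras in the sense of Grønbæk. -/
open scoped TensorProduct BigOperators ENNReal
open Filter

noncomputable section

/-- `ℓ¹(X)`: the Banach space of absolutely summable complex functions on `X`. -/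
abbrev L1 (X : Type) : Type := lp (fun _ : X => ℂ) 1

open Classical in
/-- The point mass `δ_x` in `ℓ¹(X)`. -/
noncomputable def delta {X : Type} (x : X) : L1 X := lp.single 1 x (1 : ℂ)

/-- The projective tensor norm of an element of the algebraic tensor product
`E ⊗[ℂ] F`: the infimum of `∑ ‖xᵢ‖ ‖yᵢ‖` over all finite representations
`z = ∑ xᵢ ⊗ yᵢ`. -/
def projNorm {E F : Type} [SeminormedAddCommGroup E] [NormedSpace ℂ E]
    [SeminormedAddCommGroup F] [NormedSpace ℂ F] (z : E ⊗[ℂ] F) : ℝ :=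
  sInf {r : ℝ | ∃ (n : ℕ) (x : Fin n → E) (y : Fin n → F),
    z = ∑ i, x i ⊗ₜ[ℂ] y i ∧ r = ∑ i, ‖x i‖ * ‖y i‖}

/-- `(T, φ)` is a realization of the completed projective tensor product `E ⊗̂ F`:
`T` is a Banach space, the canonical map from the algebraic tensor product is an
isometry with respect to the projective tensor norm, and it has dense range. -/
structure IsProjTensor (E F T : Type) [SeminormedAddCommGroup E] [NormedSpace ℂ E]
    [SeminormedAddCommGroup F] [NormedSpace ℂ F]
    [SeminormedAddCommGroup T] [NormedSpace ℂ T]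
    (φ : E →ₗ[ℂ] F →ₗ[ℂ] T) : Prop where
  complete : CompleteSpace T
  isometry : ∀ z : E ⊗[ℂ] F, ‖TensorProduct.lift φ z‖ = projNorm z
  dense : DenseRange ⇑(TensorProduct.lift φ)

/-- The closed linear span of the `A`-balancing relations
`{x·a ⊗ y - x ⊗ a·y}` inside a realization `T` of `E ⊗̂ F`; the quotient
`T ⧸ balancer φ r l` is the `A`-module tensor product `E ⊗̂_A F`. -/
def balancer {A E F T : Type} [SeminormedAddCommGroup E] [NormedSpace ℂ E]
    [SeminormedAddCommGroup F] [NormedSpace ℂ F]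
    [SeminormedAddCommGroup T] [NormedSpace ℂ T]
    (φ : E →ₗ[ℂ] F →ₗ[ℂ] T) (r : E → A → E) (l : A → F → F) : Submodule ℂ T :=
  (Submodule.span ℂ {z : T | ∃ (x : E) (a : A) (y : F), z = φ (r x a) y - φ x (l a y)}).topologicalClosure

/-- A left Banach `A`-module `(E, l)` is `A`-induced: for every realization `T` of
`A ⊗̂ E`, the canonical map `A ⊗̂_A E → E`, `a ⊗ x ↦ a·x`, is a topological
isomorphism. -/
def LeftInduced {A E : Type} [SeminormedAddCommGroup A] [NormedSpace ℂ A]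
    [SeminormedAddCommGroup E] [NormedSpace ℂ E]
    (mulA : A →L[ℂ] A →L[ℂ] A) (l : A →L[ℂ] E →L[ℂ] E) : Prop :=
  ∀ (T : Type) [SeminormedAddCommGroup T] [NormedSpace ℂ T]
    (φ : A →ₗ[ℂ] E →ₗ[ℂ] T), IsProjTensor A E T φ →
    ∃ e : (T ⧸ balancer φ (fun a b => mulA a b) (fun a x => l a x)) ≃L[ℂ] E,
      ∀ (a : A) (x : E), e (Submodule.Quotient.mk (φ a x)) = l a x

/-- A right Banach `A`-module `(E, r)` is `A`-induced. -/
def RightInduced {A E : Type} [SeminormedAddCommGroup A] [NormedSpace ℂ A]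
    [SeminormedAddCommGroup E] [NormedSpace ℂ E]
    (mulA : A →L[ℂ] A →L[ℂ] A) (r : E →L[ℂ] A →L[ℂ] E) : Prop :=
  ∀ (T : Type) [SeminormedAddCommGroup T] [NormedSpace ℂ T]
    (φ : E →ₗ[ℂ] A →ₗ[ℂ] T), IsProjTensor E A T φ →
    ∃ e : (T ⧸ balancer φ (fun x a => r x a) (fun a b => mulA a b)) ≃L[ℂ] E,
      ∀ (x : E) (a : A), e (Submodule.Quotient.mk (φ x a)) = r x a

/-- A Banach algebra `(A, mul)` is self-induced: the multiplication map
`A ⊗̂_A A → A` is an isomorphism of `A`-bimodules. -/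
def SelfInduced {A : Type} [SeminormedAddCommGroup A] [NormedSpace ℂ A]
    (mulA : A →L[ℂ] A →L[ℂ] A) : Prop :=
  ∀ (T : Type) [SeminormedAddCommGroup T] [NormedSpace ℂ T]
    (φ : A →ₗ[ℂ] A →ₗ[ℂ] T), IsProjTensor A A T φ →
    ∃ e : (T ⧸ balancer φ (fun a b => mulA a b) (fun a b => mulA a b)) ≃L[ℂ] A,
      (∀ a b : A, e (Submodule.Quotient.mk (φ a b)) = mulA a b) ∧
      (∀ c a b : A, e (Submodule.Quotient.mk (φ (mulA c a) b))
          = mulA c (e (Submodule.Quotient.mk (φ a b)))) ∧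
      (∀ a b c : A, e (Submodule.Quotient.mk (φ a (mulA b c)))
          = mulA (e (Submodule.Quotient.mk (φ a b))) c)

/-- `(E, l, r)` is a Banach bimodule: left over `(A, mulL)`, right over `(B, mulR)`. -/
def IsBimoduleLaw {A B E : Type} [SeminormedAddCommGroup A] [NormedSpace ℂ A]
    [SeminormedAddCommGroup B] [NormedSpace ℂ B]
    [SeminormedAddCommGroup E] [NormedSpace ℂ E]
    (mulL : A →L[ℂ] A →L[ℂ] A) (mulR : B →L[ℂ] B →L[ℂ] B)
    (l : A →L[ℂ] E →L[ℂ] E) (r : E →L[ℂ] B →L[ℂ] E) : Prop :=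
  (∀ (a a' : A) (x : E), l (mulL a a') x = l a (l a' x)) ∧
  (∀ (x : E) (b b' : B), r (r x b) b' = r x (mulR b b')) ∧
  (∀ (a : A) (x : E) (b : B), r (l a x) b = l a (r x b))

/-- A witness for Morita equivalence of `(A, mulA)` and `(B, mulB)` in the sense of
Grønbæk's characterization: two-sided induced Banach bimodules `P ∈ B-mod-A` and
`Q ∈ A-mod-B` with `P ⊗̂_A Q ≅ B` and `Q ⊗̂_B P ≅ A` as bimodules. -/
structure MoritaWitness (A B : Type) [NormedAddCommGroup A] [NormedSpace ℂ A]
    [NormedAddCommGroup B] [NormedSpace ℂ B]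
    (mulA : A →L[ℂ] A →L[ℂ] A) (mulB : B →L[ℂ] B →L[ℂ] B) : Type 1 where
  P : Type
  Q : Type
  [iP1 : NormedAddCommGroup P] [iP2 : NormedSpace ℂ P] [iP3 : CompleteSpace P]
  [iQ1 : NormedAddCommGroup Q] [iQ2 : NormedSpace ℂ Q] [iQ3 : CompleteSpace Q]
  lP : B →L[ℂ] P →L[ℂ] P
  rP : P →L[ℂ] A →L[ℂ] P
  lQ : A →L[ℂ] Q →L[ℂ] Q
  rQ : Q →L[ℂ] B →L[ℂ] Q
  lawP : IsBimoduleLaw mulB mulA lP rP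
  lawQ : IsBimoduleLaw mulA mulB lQ rQ
  indPl : LeftInduced mulB lP
  indPr : RightInduced mulA rP
  indQl : LeftInduced mulA lQ
  indQr : RightInduced mulB rQ
  isoB : ∀ (T : Type) [SeminormedAddCommGroup T] [NormedSpace ℂ T]
    (φ : P →ₗ[ℂ] Q →ₗ[ℂ] T), IsProjTensor P Q T φ →
    ∃ e : (T ⧸ balancer φ (fun x a => rP x a) (fun a y => lQ a y)) ≃L[ℂ] B,
      (∀ (b : B) (p : P) (q : Q), e (Submodule.Quotient.mk (φ (lP b p) q))
          = mulB b (e (Submodule.Quotient.mk (φ p q)))) ∧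
      (∀ (b : B) (p : P) (q : Q), e (Submodule.Quotient.mk (φ p (rQ q b)))
          = mulB (e (Submodule.Quotient.mk (φ p q))) b)
  isoA : ∀ (T : Type) [SeminormedAddCommGroup T] [NormedSpace ℂ T]
    (φ : Q →ₗ[ℂ] P →ₗ[ℂ] T), IsProjTensor Q P T φ →
    ∃ e : (T ⧸ balancer φ (fun y b => rQ y b) (fun b x => lP b x)) ≃L[ℂ] A,
      (∀ (a : A) (q : Q) (p : P), e (Submodule.Quotient.mk (φ (lQ a q) p))
          = mulA a (e (Submodule.Quotient.mk (φ q p)))) ∧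
      (∀ (a : A) (q : Q) (p : P), e (Submodule.Quotient.mk (φ q (rP p a)))
          = mulA (e (Submodule.Quotient.mk (φ q p))) a)

/-- Morita equivalence of self-induced Banach algebras, via Grønbæk's
characterization. -/
def MoritaEquivalent {A B : Type} [NormedAddCommGroup A] [NormedSpace ℂ A]
    [NormedAddCommGroup B] [NormedSpace ℂ B]
    (mulA : A →L[ℂ] A →L[ℂ] A) (mulB : B →L[ℂ] B →L[ℂ] B) : Prop :=
  Nonempty (MoritaWitness A B mulA mulB)

/-- The Brandt semigroup `B(I,G) = (I × G × I) ∪ {∘}`, with `∘ = none`. -/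
abbrev Brandt (I G : Type) : Type := Option (I × G × I)

open Classical in
/-- Multiplication of the Brandt semigroup: `(i,g,j)(i',g',j') = (i,gg',j')` if
`j = i'` and `∘` otherwise; `∘` is absorbing. -/
noncomputable instance {I G : Type} [Mul G] : Mul (Brandt I G) :=
  ⟨fun a b => match a, b with
    | some (i, g, j), some (i', g', j') => if j = i' then some (i, g * g', j') else none
    | _, _ => none⟩

open Classical in
/-- The convolution product on `ℓ¹(S)` for a (semi)group `S`:
`(a * b)(s) = ∑_{uv = s} a(u) b(v)`. -/
noncomputable def l1conv {S : Type} [Mul S] (a b : L1 S) (s : S) : ℂ :=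
  ∑' p : S × S, if p.1 * p.2 = s then a p.1 * b p.2 else 0

/-- A Banach algebra `(A, mul)` is amenable: every bounded derivation of `A` into the
dual of a Banach `A`-bimodule is inner. Here `(D b).comp (r.flip a)` is `a·(D b)` and
`(D a).comp (l b)` is `(D a)·b` in the dual bimodule `E*`. -/
def AmenableBA {A : Type} [NormedAddCommGroup A] [NormedSpace ℂ A]
    (mul : A →L[ℂ] A →L[ℂ] A) : Prop :=
  ∀ (E : Type) [NormedAddCommGroup E] [NormedSpace ℂ E] [CompleteSpace E]
    (l : A →L[ℂ] E →L[ℂ] E) (r : E →L[ℂ] A →L[ℂ] E),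
    (∀ (a a' : A) (x : E), l (mul a a') x = l a (l a' x)) →
    (∀ (x : E) (a a' : A), r (r x a) a' = r x (mul a a')) →
    (∀ (a : A) (x : E) (a' : A), r (l a x) a' = l a (r x a')) →
    ∀ D : A →L[ℂ] (E →L[ℂ] ℂ),
      (∀ a b : A, D (mul a b) = (D b).comp (r.flip a) + (D a).comp (l b)) →
      ∃ ξ : E →L[ℂ] ℂ, ∀ a : A, D a = ξ.comp (r.flip a) - ξ.comp (l a)

/-- A Banach algebra `(A, mul)` is approximately amenable: every bounded derivation
into a dual bimodule is approximately inner, i.e. a norm-limit of inner ones along a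
net. -/
def ApproxAmenableBA {A : Type} [NormedAddCommGroup A] [NormedSpace ℂ A]
    (mul : A →L[ℂ] A →L[ℂ] A) : Prop :=
  ∀ (E : Type) [NormedAddCommGroup E] [NormedSpace ℂ E] [CompleteSpace E]
    (l : A →L[ℂ] E →L[ℂ] E) (r : E →L[ℂ] A →L[ℂ] E),
    (∀ (a a' : A) (x : E), l (mul a a') x = l a (l a' x)) →
    (∀ (x : E) (a a' : A), r (r x a) a' = r x (mul a a')) →
    (∀ (a : A) (x : E) (a' : A), r (l a x) a' = l a (r x a')) →
    ∀ D : A →L[ℂ] (E →L[ℂ] ℂ),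
      (∀ a b : A, D (mul a b) = (D b).comp (r.flip a) + (D a).comp (l b)) →
      ∃ (ι : Type) (F : Filter ι), F.NeBot ∧ ∃ f : ι → (E →L[ℂ] ℂ),
        ∀ a : A, Tendsto (fun lam => (f lam).comp (r.flip a) - (f lam).comp (l a))
          F (nhds (D a))

/-- A discrete group `G` is amenable: there is a translation-invariant mean on
`ℓ∞(G)`. -/
def AmenableGroup (G : Type) [Group G] : Prop :=
  ∃ m : lp (fun _ : G => ℝ) ∞ →ₗ[ℝ] ℝ,
    (∀ f : lp (fun _ : G => ℝ) ∞, (∀ x, 0 ≤ f x) → 0 ≤ m f) ∧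
    (∀ f : lp (fun _ : G => ℝ) ∞, (∀ x, f x = 1) → m f = 1) ∧
    (∀ (g : G) (f f' : lp (fun _ : G => ℝ) ∞), (∀ x, f' x = f (g * x)) → m f' = m f)

/-! ### Universal property of `ℓ¹` -/

section L1tools

variable {X V : Type} [NormedAddCommGroup V] [NormedSpace ℂ V]

lemma l1_summable_norm (f : L1 X) : Summable (fun s => ‖f s‖) := by
  have := (lp.memℓp f).summable (by simp)
  simpa using this

lemma l1_norm_eq (f : L1 X) : ‖f‖ = ∑' s, ‖f s‖ := by
  have := lp.norm_eq_tsum_rpow (p := 1) (by simp) f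
  simpa using this

lemma l1lift_summable_norm (v : X → V) (C : ℝ) (hv : ∀ s, ‖v s‖ ≤ C) (f : L1 X) :
    Summable (fun s => ‖f s • v s‖) := by
  refine Summable.of_nonneg_of_le (fun _ => norm_nonneg _) (fun s => ?_)
    ((l1_summable_norm f).mul_right C)
  rw [norm_smul]
  exact mul_le_mul_of_nonneg_left (hv s) (norm_nonneg _)

/-- The bounded linear map on `ℓ¹(X)` determined by a bounded family of vectors. -/
def l1lift [CompleteSpace V] (v : X → V) (C : ℝ) (hv : ∀ s, ‖v s‖ ≤ C) : L1 X →L[ℂ] V :=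
  LinearMap.mkContinuous
    { toFun := fun f => ∑' s, f s • v s
      map_add' := fun f g => by
        rw [← ((l1lift_summable_norm v C hv f).of_norm).tsum_add
          ((l1lift_summable_norm v C hv g).of_norm)]
        exact tsum_congr fun s => by simp [add_smul]
      map_smul' := fun c f => by
        rw [RingHom.id_apply, ← ((l1lift_summable_norm v C hv f).of_norm).tsum_const_smul]
        exact tsum_congr fun s => by simp [mul_smul] } C
    (fun f => by
      have h := l1lift_summable_norm v C hv f
      calc ‖∑' s, f s • v s‖ ≤ ∑' s, ‖f s • v s‖ := norm_tsum_le_tsum_norm h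
        _ ≤ ∑' s, ‖f s‖ * C := by
          refine h.tsum_le_tsum (fun s => ?_) ((l1_summable_norm f).mul_right C)
          rw [norm_smul]
          exact mul_le_mul_of_nonneg_left (hv s) (norm_nonneg _)
        _ = C * ‖f‖ := by rw [tsum_mul_right, l1_norm_eq, mul_comm])

lemma l1lift_apply [CompleteSpace V] (v : X → V) (C : ℝ) (hv : ∀ s, ‖v s‖ ≤ C) (f : L1 X) :
    l1lift v C hv f = ∑' s, f s • v s := rfl

lemma l1lift_hasSum [CompleteSpace V] (v : X → V) (C : ℝ) (hv : ∀ s, ‖v s‖ ≤ C) (f : L1 X) :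
    HasSum (fun s => f s • v s) (l1lift v C hv f) :=
  ((l1lift_summable_norm v C hv f).of_norm).hasSum

lemma norm_l1lift_le [CompleteSpace V] (v : X → V) (C : ℝ) (hC : 0 ≤ C) (hv : ∀ s, ‖v s‖ ≤ C) :
    ‖l1lift v C hv‖ ≤ C :=
  LinearMap.mkContinuous_norm_le _ hC _

lemma delta_self (x : X) : (delta x : L1 X) x = 1 := by
  classical
  simp [delta]

lemma delta_ne {x y : X} (h : y ≠ x) : (delta x : L1 X) y = 0 := by
  classical
  exact lp.single_apply_ne _ _ _ h

open Classical in
lemma delta_apply (x y : X) : (delta x : L1 X) y = if x = y then 1 else 0 := by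
  split_ifs with h
  · subst h; exact delta_self x
  · exact delta_ne (Ne.symm h)

lemma norm_delta (x : X) : ‖(delta x : L1 X)‖ = 1 := by
  classical
  simp [delta, lp.norm_single]

@[simp] lemma l1lift_delta [CompleteSpace V] (v : X → V) (C : ℝ) (hv : ∀ s, ‖v s‖ ≤ C) (x : X) :
    l1lift v C hv (delta x) = v x := by
  rw [l1lift_apply, tsum_eq_single x]
  · simp [delta_self]
  · intro y hy; simp [delta_ne hy]

lemma l1_hasSum_delta (f : L1 X) : HasSum (fun s => f s • (delta s : L1 X)) f := by
  classical
  have := lp.hasSum_single (p := 1) (by simp) f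
  convert this using 2 with s
  ext t
  by_cases h : t = s
  · subst h; simp [delta_self]
  · rw [lp.single_apply_ne _ _ _ h]; simp [delta_ne h]

lemma l1_ext {V : Type} [AddCommMonoid V] [Module ℂ V] [TopologicalSpace V] [T2Space V]
    {f g : L1 X →L[ℂ] V} (h : ∀ x, f (delta x) = g (delta x)) : f = g := by
  ext a
  have h1 := (l1_hasSum_delta a).mapL f
  have h2 := (l1_hasSum_delta a).mapL g
  simp only [map_smul, h] at h1 h2
  exact h1.unique h2

end L1tools

/-! ### Rectangular Brandt products -/

section Rect

variable {I J K L G : Type} [Group G]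

open Classical in
/-- Product of "rectangular" Brandt elements. -/
def rmul : Option (I × G × J) → Option (J × G × K) → Option (I × G × K) :=
  fun a b => match a, b with
    | some (i, g, j), some (i', g', j') => if j = i' then some (i, g * g', j') else none
    | _, _ => none

lemma brandt_mul_eq (s t : Brandt I G) : s * t = rmul s t := by
  rcases s with _ | ⟨i, g, j⟩
  · rfl
  rcases t with _ | ⟨j', h, k⟩
  · rfl
  rfl

open Classical in
lemma rmul_some (i : I) (g : G) (j j' : J) (h : G) (k : K) :
    rmul (some (i, g, j)) (some (j', h, k)) = if j = j' then some (i, g * h, k) else none := rfl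

lemma rmul_same (i : I) (g : G) (j : J) (h : G) (k : K) :
    rmul (some (i, g, j)) (some (j, h, k)) = some (i, g * h, k) := by
  rw [rmul_some, if_pos rfl]

lemma rmul_ne (i : I) (g : G) {j j' : J} (hj : j ≠ j') (h : G) (k : K) :
    rmul (some (i, g, j)) (some (j', h, k)) = none := by
  rw [rmul_some, if_neg hj]

lemma rmul_none_left (t : Option (J × G × K)) :
    rmul (none : Option (I × G × J)) t = none := rfl

lemma rmul_none_right (s : Option (I × G × J)) :
    rmul s (none : Option (J × G × K)) = none := by
  cases s <;> rfl

lemma rmul_assoc (s : Option (I × G × J)) (t : Option (J × G × K)) (u : Option (K × G × L)) :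
    rmul (rmul s t) u = rmul s (rmul t u) := by
  classical
  rcases s with _ | ⟨i, g, j⟩
  · rfl
  rcases t with _ | ⟨j', h, k⟩
  · rfl
  rcases u with _ | ⟨k', f, l⟩
  · rw [rmul_none_right, rmul_none_right, rmul_none_right]
  by_cases h1 : j = j' <;> by_cases h2 : k = k'
  · subst h1; subst h2; simp only [rmul_same, mul_assoc]
  · subst h1; rw [rmul_same, rmul_ne _ _ h2, rmul_ne _ _ h2, rmul_none_right]
  · subst h2; rw [rmul_same, rmul_ne _ _ h1, rmul_ne _ _ h1, rmul_none_left]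
  · rw [rmul_ne _ _ h2, rmul_ne _ _ h1, rmul_none_left, rmul_none_right]

/-- The convolution product of rectangular Brandt `ℓ¹` spaces. -/
def rconv (I J K G : Type) [Group G] : L1 (Option (I × G × J)) →L[ℂ] L1 (Option (J × G × K)) →L[ℂ]
    L1 (Option (I × G × K)) :=
  l1lift (fun s => l1lift (fun t => delta (rmul s t)) 1 (fun _ => (norm_delta _).le)) 1
    (fun _ => norm_l1lift_le _ _ zero_le_one _)

@[simp] lemma rconv_delta (s : Option (I × G × J)) (t : Option (J × G × K)) :
    rconv I J K G (delta s) (delta t) = delta (rmul s t) := by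
  simp [rconv]

lemma rconv_norm_le (x : L1 (Option (I × G × J))) (y : L1 (Option (J × G × K))) :
    ‖rconv I J K G x y‖ ≤ ‖x‖ * ‖y‖ := by
  have h1 : ‖rconv I J K G‖ ≤ 1 := norm_l1lift_le _ _ zero_le_one _
  calc ‖rconv I J K G x y‖ ≤ ‖rconv I J K G‖ * ‖x‖ * ‖y‖ := (rconv I J K G).le_opNorm₂ x y
    _ ≤ 1 * ‖x‖ * ‖y‖ := by gcongr
    _ = ‖x‖ * ‖y‖ := by ring

lemma l1_bilin_ext {X Y V : Type} [NormedAddCommGroup V] [NormedSpace ℂ V]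
    {f g : L1 X →L[ℂ] L1 Y →L[ℂ] V} (h : ∀ x y, f (delta x) (delta y) = g (delta x) (delta y)) :
    f = g := l1_ext fun x => l1_ext fun y => h x y

lemma rconv_assoc (a : L1 (Option (I × G × J))) (b : L1 (Option (J × G × K)))
    (c : L1 (Option (K × G × L))) :
    rconv I K L G (rconv I J K G a b) c = rconv I J L G a (rconv J K L G b c) := by
  have h1 : ∀ s t, (rconv I K L G (rconv I J K G (delta s) (delta t))) c =
      (rconv I J L G (delta s)) (rconv J K L G (delta t) c) := by
    intro s t
    refine congrArg (fun F : _ →L[ℂ] L1 (Option (I × G × L)) => F c)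
      (l1_ext (f := (rconv I K L G (rconv I J K G (delta s) (delta t))))
      (g := (rconv I J L G (delta s)).comp (rconv J K L G (delta t))) fun u => ?_)
    simp [rmul_assoc]
  have h2 : ∀ s, (rconv I K L G (rconv I J K G (delta s) b)) c =
      (rconv I J L G (delta s)) (rconv J K L G b c) := by
    intro s
    refine congrArg (fun F : _ →L[ℂ] L1 (Option (I × G × L)) => F b)
      (l1_ext (f := ((rconv I K L G).flip c).comp (rconv I J K G (delta s)))
      (g := (rconv I J L G (delta s)).comp ((rconv J K L G).flip c)) fun t => ?_)
    exact h1 s t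
  refine congrArg (fun F : _ →L[ℂ] L1 (Option (I × G × L)) => F a)
      (l1_ext (f := ((rconv I K L G).flip c).comp ((rconv I J K G).flip b))
      (g := (rconv I J L G).flip (rconv J K L G b c)) fun s => ?_)
  exact h2 s

/-- Evaluation at a point as a bounded functional on `ℓ¹`. -/
def l1ev {X : Type} (s : X) : L1 X →L[ℂ] ℂ := LinearMap.mkContinuous
    { toFun := fun f => f s, map_add' := fun _ _ => rfl, map_smul' := fun _ _ => rfl } 1
    (fun f => by
      rw [one_mul]
      exact lp.norm_apply_le_norm one_ne_zero f s)

lemma l1ev_apply {X : Type} (s : X) (f : L1 X) : l1ev s f = f s := rfl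

open Classical in
lemma l1conv_eq {S : Type} [Mul S] (a b : L1 S) (s : S) :
    l1conv a b s = ∑' u, ∑' v, if u * v = s then a u * b v else 0 := by
  have hs : Summable (fun p : S × S => if p.1 * p.2 = s then a p.1 * b p.2 else 0) := by
    have h := (l1_summable_norm a).mul_of_nonneg (l1_summable_norm b)
      (fun _ => norm_nonneg _) (fun _ => norm_nonneg _)
    refine Summable.of_norm_bounded h fun p => ?_
    split_ifs
    · rw [norm_mul]
    · rw [norm_zero]; positivity
  rw [l1conv, hs.tsum_prod]

lemma rconv_apply_eq (a b : L1 (Brandt I G)) (s : Brandt I G) :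
    rconv I I I G a b s = l1conv a b s := by
  have h1 : HasSum (fun u => a u • l1ev s (rconv I I I G (delta u) b))
      (l1ev s (rconv I I I G a b)) := by
    have := ((l1_hasSum_delta a).mapL ((rconv I I I G).flip b)).mapL (l1ev s)
    simpa using this
  have h2 : ∀ u, HasSum (fun v => b v • l1ev s (rconv I I I G (delta u) (delta v)))
      (l1ev s (rconv I I I G (delta u) b)) := by
    intro u
    have := ((l1_hasSum_delta b).mapL (rconv I I I G (delta u))).mapL (l1ev s)
    simpa using this
  rw [l1conv_eq, ← l1ev_apply, ← h1.tsum_eq]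
  refine tsum_congr fun u => ?_
  rw [← (h2 u).tsum_eq, ← tsum_const_smul'' ]
  refine tsum_congr fun v => ?_
  have huv := brandt_mul_eq u v
  simp only [rconv_delta, l1ev_apply, delta_apply, smul_eq_mul]
  by_cases h : rmul u v = s
  · rw [if_pos h, if_pos (huv.trans h), mul_one]
  · rw [if_neg h, if_neg (fun h' => h (huv.symm.trans h')), mul_zero, mul_zero]

end Rect


/-! ### Module tensor products of rectangular Brandt spaces -/

section Tensor

lemma projNorm_set_nonempty {E F : Type} [SeminormedAddCommGroup E] [NormedSpace ℂ E]
    [SeminormedAddCommGroup F] [NormedSpace ℂ F] (z : E ⊗[ℂ] F) :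
    {r : ℝ | ∃ (n : ℕ) (x : Fin n → E) (y : Fin n → F),
    z = ∑ i, x i ⊗ₜ[ℂ] y i ∧ r = ∑ i, ‖x i‖ * ‖y i‖}.Nonempty := by
  obtain ⟨n, x, y, h⟩ := TensorProduct.exists_sum_tmul_eq z
  exact ⟨_, n, x, y, h, rfl⟩

lemma lift_norm_le_projNorm {E F V : Type} [SeminormedAddCommGroup E] [NormedSpace ℂ E]
    [SeminormedAddCommGroup F] [NormedSpace ℂ F] [SeminormedAddCommGroup V] [NormedSpace ℂ V]
    (m : E →ₗ[ℂ] F →ₗ[ℂ] V) (hm : ∀ x y, ‖m x y‖ ≤ ‖x‖ * ‖y‖) (z : E ⊗[ℂ] F) :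
    ‖TensorProduct.lift m z‖ ≤ projNorm z := by
  refine le_csInf (projNorm_set_nonempty z) ?_
  rintro r ⟨n, x, y, rfl, rfl⟩
  rw [map_sum]
  refine (norm_sum_le _ _).trans (Finset.sum_le_sum fun i _ => ?_)
  simpa using hm (x i) (y i)

lemma projNorm_tmul_le {E F : Type} [SeminormedAddCommGroup E] [NormedSpace ℂ E]
    [SeminormedAddCommGroup F] [NormedSpace ℂ F] (x : E) (y : F) :
    projNorm (x ⊗ₜ[ℂ] y) ≤ ‖x‖ * ‖y‖ := by
  refine csInf_le ⟨0, ?_⟩ ⟨1, fun _ => x, fun _ => y, by simp, by simp⟩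
  rintro r ⟨n, x, y, -, rfl⟩
  positivity

variable {I J K G : Type} [Group G]

theorem tensor_iso [Nonempty J] (T : Type) [SeminormedAddCommGroup T] [NormedSpace ℂ T]
    (φ : L1 (Option (I × G × J)) →ₗ[ℂ] L1 (Option (J × G × K)) →ₗ[ℂ] T)
    (hT : IsProjTensor (L1 (Option (I × G × J))) (L1 (Option (J × G × K))) T φ) :
    ∃ e : (T ⧸ balancer φ (fun x a => rconv I J J G x a) (fun a y => rconv J J K G a y))
      ≃L[ℂ] L1 (Option (I × G × K)),
      ∀ x y, e (Submodule.Quotient.mk (φ x y)) = rconv I J K G x y := by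
  obtain ⟨j0⟩ := ‹Nonempty J›
  have := hT.complete
  set N := balancer φ (fun x a => rconv I J J G x a) (fun a y => rconv J J K G a y) with hN
  have hNc : IsClosed (N : Set T) := Submodule.isClosed_topologicalClosure _
  have hφ : ∀ x y, ‖φ x y‖ ≤ 1 * ‖x‖ * ‖y‖ := by
    intro x y
    have := hT.isometry (x ⊗ₜ y)
    rw [TensorProduct.lift.tmul] at this
    rw [this, one_mul]
    exact projNorm_tmul_le x y
  let Φ : L1 (Option (I × G × J)) →L[ℂ] L1 (Option (J × G × K)) →L[ℂ] T :=
    LinearMap.mkContinuous₂ φ 1 hφ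
  have hΦ : ∀ x y, Φ x y = φ x y := fun x y => rfl
  -- the quotient map
  let q : T →L[ℂ] T ⧸ N := LinearMap.mkContinuous N.mkQ 1
    (fun t => by simpa using Submodule.Quotient.norm_mk_le N t)
  have hq : ∀ t, q t = Submodule.Quotient.mk t := fun t => rfl
  have hbal : ∀ x a y, q (φ (rconv I J J G x a) y) = q (φ x (rconv J J K G a y)) := by
    intro x a y
    rw [hq, hq, Submodule.Quotient.eq]
    exact Submodule.le_topologicalClosure _ (Submodule.subset_span ⟨x, a, y, rfl⟩)
  -- the multiplication map on `T`
  let m : L1 (Option (I × G × J)) →ₗ[ℂ] L1 (Option (J × G × K)) →ₗ[ℂ] L1 (Option (I × G × K)) :=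
    LinearMap.mk₂ ℂ (fun x y => rconv I J K G x y) (by simp) (by simp) (by simp) (by simp)
  have hm : ∀ x y, m x y = rconv I J K G x y := fun x y => rfl
  have hbd : ∃ C, ∀ z, ‖TensorProduct.lift m z‖ ≤ C * ‖TensorProduct.lift φ z‖ :=
    ⟨1, fun z => by
      rw [hT.isometry, one_mul]
      exact lift_norm_le_projNorm m (fun x y => rconv_norm_le x y) z⟩
  let g : T →L[ℂ] L1 (Option (I × G × K)) :=
    (TensorProduct.lift m).extendOfNorm (TensorProduct.lift φ)
  have hg : ∀ x y, g (φ x y) = rconv I J K G x y := by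
    intro x y
    have := LinearMap.extendOfNorm_eq hT.dense hbd (x ⊗ₜ y)
    rw [TensorProduct.lift.tmul, TensorProduct.lift.tmul] at this
    exact this
  have hgN : N ≤ LinearMap.ker g.toLinearMap := by
    refine Submodule.topologicalClosure_minimal _ ?_ ?_
    · rw [Submodule.span_le]
      rintro _ ⟨x, a, y, rfl⟩
      simp [hg, rconv_assoc]
    · exact g.isClosed_ker
  let gq : (T ⧸ N) →ₗ[ℂ] L1 (Option (I × G × K)) := N.liftQ g.toLinearMap hgN
  have hgq : ∀ t, gq (q t) = g t := fun t => rfl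
  have hgqc : Continuous gq := by
    refine (Submodule.isQuotientMap_mkQ N).continuous_iff.2 ?_
    exact g.continuous
  -- the inverse
  let w : Option (I × G × K) → T ⧸ N := fun s => match s with
    | none => q (φ (delta none) (delta none))
    | some (i, g, k) => q (φ (delta (some (i, 1, j0))) (delta (some (j0, g, k))))
  have hqn : ∀ s t, ‖q (φ (delta s) (delta t))‖ ≤ 1 := by
    intro s t
    refine (Submodule.Quotient.norm_mk_le N _).trans ?_
    simpa [norm_delta] using hφ (delta s) (delta t)
  have hw : ∀ s, ‖w s‖ ≤ 1 := by
    rintro (_ | ⟨i, g, k⟩) <;> exact hqn _ _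
  let ψ : L1 (Option (I × G × K)) →L[ℂ] T ⧸ N := l1lift w 1 hw
  have hψ : ∀ s, ψ (delta s) = w s := fun s => l1lift_delta _ _ _ _
  have key : ∀ s t, q (φ (delta s) (delta t)) = w (rmul s t) := by
    have hb : ∀ (s : Option (I × G × J)) (a : Option (J × G × J)) (t : Option (J × G × K)),
        q (φ (delta (rmul s a)) (delta t)) = q (φ (delta s) (delta (rmul a t))) := by
      intro s a t
      have := hbal (delta s) (delta a) (delta t)
      simpa using this
    have hsn : ∀ s : Option (I × G × J), q (φ (delta s) (delta none)) = w none := by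
      intro s
      have := hb s none none
      rw [rmul_none_right, rmul_none_right] at this
      exact this.symm
    have hnt : ∀ t : Option (J × G × K), q (φ (delta none) (delta t)) = w none := by
      intro t
      have := hb none none t
      rw [rmul_none_left, rmul_none_left] at this
      exact this
    rintro (_ | ⟨i, g, j⟩) t
    · exact hnt t
    rcases t with _ | ⟨j', h, k⟩
    · exact hsn _
    by_cases hj : j = j'
    · subst hj
      have := hb (some (i, 1, j0)) (some (j0, g, j)) (some (j, h, k))
      rw [rmul_same, rmul_same, one_mul] at this
      rw [this, rmul_same]
    · have := hb (some (i, g, j)) (some (j, 1, j)) (some (j', h, k))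
      rw [rmul_same, mul_one, rmul_ne _ _ hj] at this
      rw [this, hsn, rmul_ne _ _ hj]
  have hψq : ∀ x y, ψ (rconv I J K G x y) = q (φ x y) := by
    have : (ContinuousLinearMap.compL ℂ _ _ _ ψ).comp (rconv I J K G) =
        (ContinuousLinearMap.compL ℂ _ _ _ q).comp Φ := by
      refine l1_bilin_ext fun s t => ?_
      have h1 := key s t
      simp only [ContinuousLinearMap.comp_apply, ContinuousLinearMap.compL_apply, rconv_delta, hψ]
      exact h1.symm
    intro x y
    exact congrArg (fun F => F x y) this
  have hleft : ∀ t, ψ (g t) = q t := by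
    have hd : (fun t => ψ (g t)) = fun t => q t := by
      refine hT.dense.equalizer (ψ.continuous.comp g.continuous) q.continuous ?_
      funext z
      induction z using TensorProduct.induction_on with
      | zero => simp
      | tmul x y => simp [hg, hψq]
      | add a b ha hb =>
        simp only [Function.comp_apply, map_add] at ha hb ⊢
        rw [ha, hb]
    exact fun t => congrFun hd t
  have hright : ∀ s, gq (ψ s) = s := by
    have : (⟨gq, hgqc⟩ : (T ⧸ N) →L[ℂ] L1 (Option (I × G × K))).comp ψ =
        ContinuousLinearMap.id ℂ _ := by
      refine l1_ext fun s => ?_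
      simp only [ContinuousLinearMap.comp_apply, hψ, ContinuousLinearMap.id_apply]
      change gq (w s) = delta s
      rcases s with _ | ⟨i, h, k⟩
      · change g (φ _ _) = _
        rw [hg, rconv_delta, rmul_none_left]
      · change g (φ _ _) = _
        rw [hg, rconv_delta, rmul_same, one_mul]
    intro s
    exact congrArg (fun F : _ →L[ℂ] _ => F s) this
  refine ⟨ContinuousLinearEquiv.mk
    { gq with
      invFun := ψ
      left_inv := fun t => by
        obtain ⟨t, rfl⟩ := Submodule.Quotient.mk_surjective _ t
        exact hleft t
      right_inv := hright } hgqc ψ.continuous, fun x y => hg x y⟩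

end Tensor


/-! ### Amenability for finite index set -/

section Amen

/-- Boundedness of a function. -/
def Bdd {G V : Type} [NormedAddCommGroup V] (F : G → V) (C : ℝ) : Prop := ∀ g, ‖F g‖ ≤ C

lemma exists_rmean {G : Type} [Group G] (hG : AmenableGroup G) :
    ∃ M : (G → ℝ) → ℝ,
      (∀ F F' C C', Bdd F C → Bdd F' C' → M (fun g => F g + F' g) = M F + M F') ∧
      (∀ (c : ℝ) F C, Bdd F C → M (fun g => c * F g) = c * M F) ∧
      (∀ F C, Bdd F C → |M F| ≤ C) ∧
      (∀ c : ℝ, M (fun _ => c) = c) ∧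
      (∀ (h : G) F C, Bdd F C → M (fun g => F (h * g)) = M F) := by
  classical
  obtain ⟨m, hpos, hone, hinv⟩ := hG
  have hmem : ∀ {F : G → ℝ} {C}, Bdd F C → Memℓp F ∞ := by
    intro F C h
    refine memℓp_infty ⟨C, ?_⟩
    rintro _ ⟨g, rfl⟩
    exact h g
  let M : (G → ℝ) → ℝ := fun F => if h : Memℓp F ∞ then m ⟨F, h⟩ else 0
  have hM : ∀ {F : G → ℝ} {C} (h : Bdd F C), M F = m ⟨F, hmem h⟩ :=
    fun h => dif_pos (hmem h)
  have hadd : ∀ F F' C C', Bdd F C → Bdd F' C' → M (fun g => F g + F' g) = M F + M F' := by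
    intro F F' C C' h h'
    have h2 : Bdd (fun g => F g + F' g) (C + C') :=
      fun g => (norm_add_le _ _).trans (add_le_add (h g) (h' g))
    rw [hM h, hM h', hM h2, ← map_add]
    rfl
  have hsmul : ∀ (c : ℝ) F C, Bdd F C → M (fun g => c * F g) = c * M F := by
    intro c F C h
    have h2 : Bdd (fun g => c * F g) (|c| * C) := fun g => by
      rw [norm_mul, Real.norm_eq_abs c]
      exact mul_le_mul_of_nonneg_left (h g) (abs_nonneg _)
    rw [hM h, hM h2]
    exact m.map_smul c ⟨F, hmem h⟩
  have hc1 : M (fun _ => (1 : ℝ)) = 1 := by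
    have h : Bdd (fun _ : G => (1 : ℝ)) 1 := fun g => by simp
    rw [hM h]
    exact hone _ (fun _ => rfl)
  have hconst : ∀ c : ℝ, M (fun _ => c) = c := by
    intro c
    have := hsmul c (fun _ => 1) 1 (fun g => by simp)
    simpa [hc1] using this
  have hle : ∀ F C, Bdd F C → M F ≤ C := by
    intro F C h
    have h0 : Bdd (fun _ : G => C) |C| := fun g => le_rfl
    have h1 : Bdd (fun g => (-1) * F g) C := fun g => by simpa using h g
    have h2 : Bdd (fun g => C + (-1) * F g) (|C| + C) :=
      fun g => (norm_add_le _ _).trans (add_le_add (h0 g) (h1 g))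
    have h3 : 0 ≤ M (fun g => C + (-1) * F g) := by
      rw [hM h2]
      refine hpos _ fun g => ?_
      have := (abs_le.1 (h g)).2
      change 0 ≤ C + (-1) * F g
      linarith
    rw [hadd _ _ _ _ h0 h1, hsmul _ _ _ h, hconst] at h3
    linarith
  refine ⟨M, hadd, hsmul, fun F C h => abs_le.2 ⟨?_, hle F C h⟩, hconst, ?_⟩
  · have h1 : Bdd (fun g => (-1) * F g) C := fun g => by simpa using h g
    have := hle _ _ h1
    rw [hsmul _ _ _ h] at this
    linarith
  · intro h F C hF
    have h2 : Bdd (fun g => F (h * g)) C := fun g => hF _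
    rw [hM hF, hM h2]
    exact hinv h _ _ (fun _ => rfl)

lemma exists_cmean {G : Type} [Group G] (hG : AmenableGroup G) :
    ∃ M : (G → ℂ) → ℂ,
      (∀ F F' C C', Bdd F C → Bdd F' C' → M (fun g => F g + F' g) = M F + M F') ∧
      (∀ (c : ℂ) F C, Bdd F C → M (fun g => c * F g) = c * M F) ∧
      (∀ F C, Bdd F C → ‖M F‖ ≤ 2 * C) ∧
      (∀ c : ℂ, M (fun _ => c) = c) ∧
      (∀ (h : G) F C, Bdd F C → M (fun g => F (h * g)) = M F) := by
  obtain ⟨m, hadd, hsmul, hbd, hconst, hinv⟩ := exists_rmean hG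
  have hre : ∀ {F : G → ℂ} {C}, Bdd F C → Bdd (fun g => (F g).re) C :=
    fun h g => (Complex.abs_re_le_norm _).trans (h g)
  have him : ∀ {F : G → ℂ} {C}, Bdd F C → Bdd (fun g => (F g).im) C :=
    fun h g => (Complex.abs_im_le_norm _).trans (h g)
  have hb : ∀ (c : ℝ) {F : G → ℝ} {C}, Bdd F C → Bdd (fun g => c * F g) (|c| * C) := by
    intro c F C h g
    rw [norm_mul, Real.norm_eq_abs c]
    exact mul_le_mul_of_nonneg_left (h g) (abs_nonneg _)
  refine ⟨fun F => ⟨m (fun g => (F g).re), m (fun g => (F g).im)⟩, ?_, ?_, ?_, ?_, ?_⟩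
  · intro F F' C C' h h'
    apply Complex.ext
    · simpa using hadd _ _ _ _ (hre h) (hre h')
    · simpa using hadd _ _ _ _ (him h) (him h')
  · intro c F C h
    apply Complex.ext
    · have := hadd _ _ _ _ (hb c.re (hre h)) (hb (-c.im) (him h))
      rw [hsmul _ _ _ (hre h), hsmul _ _ _ (him h)] at this
      simpa [sub_eq_add_neg] using this
    · have := hadd _ _ _ _ (hb c.re (him h)) (hb (c.im) (hre h))
      rw [hsmul _ _ _ (hre h), hsmul _ _ _ (him h)] at this
      simpa using this
  · intro F C h
    refine (Complex.norm_le_abs_re_add_abs_im _).trans ?_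
    have h1 := hbd _ _ (hre h)
    have h2 := hbd _ _ (him h)
    simp only
    linarith
  · intro c
    apply Complex.ext <;> simp [hconst]
  · intro h F C hF
    apply Complex.ext
    · exact hinv h _ _ (hre hF)
    · exact hinv h _ _ (him hF)

/-- A virtual diagonal together with an identity forces amenability. -/
lemma amenable_of_virtual {A : Type} [NormedAddCommGroup A] [NormedSpace ℂ A]
    (mul : A →L[ℂ] A →L[ℂ] A) (u : A) (hul : ∀ a, mul u a = a) (hur : ∀ a, mul a u = a)
    (V : (A →L[ℂ] A →L[ℂ] ℂ) →L[ℂ] ℂ)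
    (hV : ∀ (B B₁ B₂ : A →L[ℂ] A →L[ℂ] ℂ) (c : A), (∀ a b, B₁ a b = B (mul c a) b) →
      (∀ a b, B₂ a b = B a (mul b c)) → V B₁ = V B₂)
    (hVu : ∀ (B : A →L[ℂ] A →L[ℂ] ℂ) (f : A →L[ℂ] ℂ), (∀ a b, B a b = f (mul a b)) → V B = f u) :
    AmenableBA mul := by
  intro E _ _ _ l r hl hr hlr D hD
  have hD' : ∀ a b x, D (mul a b) x = D b (r x a) + D a (l b x) := by
    intro a b x
    rw [hD a b]; rfl
  -- the bilinear form `(a, b) ↦ D b (x · a)`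
  let Bx : E →L[ℂ] (A →L[ℂ] A →L[ℂ] ℂ) := (ContinuousLinearMap.compL ℂ A E (A →L[ℂ] ℂ) D.flip).comp r
  have hBx : ∀ x a b, Bx x a b = D b (r x a) := fun x a b => rfl
  let ξ : E →L[ℂ] ℂ := V.comp Bx
  have hξ : ∀ c x, ξ (r x c) - ξ (l c x) = D c (r x u) := by
    intro c x
    let f : A →L[ℂ] ℂ := (D c).comp (r x)
    let B₂ : A →L[ℂ] A →L[ℂ] ℂ := Bx (l c x) + (ContinuousLinearMap.compL ℂ A A ℂ f).comp mul
    let B₃ : A →L[ℂ] A →L[ℂ] ℂ := (ContinuousLinearMap.compL ℂ A A ℂ f).comp mul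
    have h1 : V (Bx (r x c)) = V B₂ := by
      refine hV (Bx x) _ _ c (fun a b => ?_) (fun a b => ?_)
      · rw [hBx, hBx, hr]
      · change Bx (l c x) a b + (D c) (r x (mul a b)) = _
        rw [hBx, hBx, hD', hlr, hr]
        ring
    have h2 : V B₃ = f u := hVu B₃ f (fun a b => rfl)
    have h3 : V B₂ = V (Bx (l c x)) + V B₃ := map_add V _ _
    change V (Bx (r x c)) - V (Bx (l c x)) = f u
    rw [h1, h3, h2]; ring
  let η : E →L[ℂ] ℂ := ξ - D u + (D u).comp (r.flip u)
  have hη : ∀ x, η x = ξ x - D u x + D u (r x u) := fun x => rfl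
  refine ⟨η, fun c => ?_⟩
  ext x
  change D c x = η (r x c) - η (l c x)
  have e1 := hξ c x
  have e2 := hD' c u x
  have e3 := hD' u c x
  have e4 := hD' u c (r x u)
  have e5 := hD' c u (r x u)
  have e6 := hD' c u (l c x)
  rw [hul] at e3 e4
  rw [hur] at e2 e5
  rw [hη, hη, hr, hur]
  rw [hr, hul] at e4
  rw [hlr]
  linear_combination e3 - e4 - e1

lemma approxAmenable_of_amenable {A : Type} [NormedAddCommGroup A] [NormedSpace ℂ A]
    (mul : A →L[ℂ] A →L[ℂ] A) (h : AmenableBA mul) : ApproxAmenableBA mul := by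
  intro E _ _ _ l r hl hr hlr D hD
  obtain ⟨ξ, hξ⟩ := h E l r hl hr hlr D hD
  refine ⟨Unit, ⊤, inferInstance, fun _ => ξ, fun a => ?_⟩
  rw [hξ a]
  exact tendsto_const_nhds

variable {I G : Type} [Group G]

/-- The matrix unit `δ_{(i,g,j)} - δ_∘`. -/
def eps (i : I) (g : G) (j : I) : L1 (Brandt I G) := delta (some (i, g, j)) - delta none

lemma norm_eps_le (i : I) (g : G) (j : I) : ‖eps i g j‖ ≤ 2 := by
  refine (norm_sub_le _ _).trans ?_
  rw [norm_delta, norm_delta]; norm_num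

lemma eps_mul_same (i : I) (g : G) (j : I) (h : G) (k : I) :
    rconv I I I G (eps i g j) (eps j h k) = eps i (g * h) k := by
  simp [eps, rmul_same, rmul_none_left, rmul_none_right]

lemma eps_mul_ne (i : I) (g : G) {j j' : I} (hj : j ≠ j') (h : G) (k : I) :
    rconv I I I G (eps i g j) (eps j' h k) = 0 := by
  simp [eps, rmul_ne _ _ hj, rmul_none_left, rmul_none_right]

lemma eps_mul_none (i : I) (g : G) (j : I) :
    rconv I I I G (eps i g j) (delta none) = 0 := by
  simp [eps, rmul_none_left, rmul_none_right]

lemma none_mul_eps (i : I) (g : G) (j : I) :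
    rconv I I I G (delta none) (eps i g j) = 0 := by
  simp [eps, rmul_none_left, rmul_none_right]

lemma none_mul_none :
    rconv I I I G (delta none) (delta none) = delta none := by
  simp [rmul_none_left]

theorem brandt_amenable [Nonempty I] [Finite I] (hG : AmenableGroup G) :
    AmenableBA (rconv I I I G) := by
  classical
  have := Fintype.ofFinite I
  obtain ⟨i0⟩ := ‹Nonempty I›
  obtain ⟨M, hadd, hsmul, hbd, hconst, hinv⟩ := exists_cmean hG
  set mul := rconv I I I G with hmul
  let u : L1 (Brandt I G) := ∑ i : I, eps i 1 i + delta none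
  have hu : u = ∑ i : I, eps i 1 i + delta none := rfl
  have hsome : ∀ i g j, (delta (some (i, g, j)) : L1 (Brandt I G)) = eps i g j + delta none := by
    intro i g j; simp [eps]
  have hA : ∀ {V : Type} [NormedAddCommGroup V] [NormedSpace ℂ V]
      (f g : L1 (Brandt I G) →L[ℂ] V), (∀ i h j, f (eps i h j) = g (eps i h j)) →
      f (delta none) = g (delta none) → f = g := by
    intro V _ _ f g h1 h2
    refine l1_ext ?_
    rintro (_ | ⟨i, h, j⟩)
    · exact h2
    · rw [hsome, map_add, map_add, h1, h2]
  have hul : ∀ a, mul u a = a := by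
    have : mul u = ContinuousLinearMap.id ℂ _ := by
      refine hA _ _ (fun i h j => ?_) ?_
      · rw [hu, map_add, map_sum]
        simp only [ContinuousLinearMap.add_apply, ContinuousLinearMap.sum_apply]
        rw [Finset.sum_eq_single i, eps_mul_same, one_mul, none_mul_eps, add_zero]; rfl
        · intro b _ hb; exact eps_mul_ne _ _ hb _ _
        · simp
      · rw [hu, map_add, map_sum]
        simp only [ContinuousLinearMap.add_apply, ContinuousLinearMap.sum_apply]
        rw [Finset.sum_eq_zero, none_mul_none, zero_add]; rfl
        intro i _; exact eps_mul_none _ _ _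
    intro a; rw [this]; rfl
  have hur : ∀ a, mul a u = a := by
    have : mul.flip u = ContinuousLinearMap.id ℂ _ := by
      refine hA _ _ (fun i h j => ?_) ?_
      · rw [ContinuousLinearMap.flip_apply, hu, map_add, map_sum]
        rw [Finset.sum_eq_single j, eps_mul_same, mul_one, eps_mul_none, add_zero]; rfl
        · intro b _ hb; exact eps_mul_ne _ _ hb.symm _ _
        · simp
      · rw [ContinuousLinearMap.flip_apply, hu, map_add, map_sum]
        rw [Finset.sum_eq_zero, none_mul_none, zero_add]; rfl
        intro i _; exact none_mul_eps _ _ _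
    intro a; rw [← ContinuousLinearMap.flip_apply, this]; rfl
  -- the averaging integrand
  let Fg : (L1 (Brandt I G) →L[ℂ] L1 (Brandt I G) →L[ℂ] ℂ) → G → ℂ := fun B g =>
    ∑ i : I, B (eps i g i0) (eps i0 g⁻¹ i)
  have hB0 : ∀ (B : L1 (Brandt I G) →L[ℂ] L1 (Brandt I G) →L[ℂ] ℂ) (i j k l : I) (g h : G),
      ‖B (eps i g j) (eps k h l)‖ ≤ ‖B‖ * 4 := by
    intro B i j k l g h
    calc ‖B (eps i g j) (eps k h l)‖ ≤ ‖B‖ * ‖eps i g j‖ * ‖eps k h l‖ := B.le_opNorm₂ _ _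
      _ ≤ ‖B‖ * 2 * 2 := by gcongr <;> exact norm_eps_le _ _ _
      _ = ‖B‖ * 4 := by ring
  have hFg : ∀ B, Bdd (Fg B) (Fintype.card I * (‖B‖ * 4)) := by
    intro B g
    refine (norm_sum_le _ _).trans ?_
    refine (Finset.sum_le_card_nsmul _ _ (‖B‖ * 4) (fun i _ => hB0 _ _ _ _ _ _ _)).trans ?_
    simp
  let V : (L1 (Brandt I G) →L[ℂ] L1 (Brandt I G) →L[ℂ] ℂ) →L[ℂ] ℂ := LinearMap.mkContinuous
    { toFun := fun B => M (Fg B) + B (delta none) (delta none)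
      map_add' := fun B B' => by
        have h1 : Fg (B + B') = fun g => Fg B g + Fg B' g := by
          funext g; simp [Fg, Finset.sum_add_distrib]
        rw [h1, hadd _ _ _ _ (hFg B) (hFg B')]
        simp only [ContinuousLinearMap.add_apply]
        ring
      map_smul' := fun c B => by
        have h1 : Fg (c • B) = fun g => c * Fg B g := by
          funext g; simp [Fg, Finset.mul_sum]
        rw [h1, hsmul _ _ _ (hFg B)]
        simp only [ContinuousLinearMap.smul_apply, RingHom.id_apply, smul_eq_mul]
        ring } (2 * (Fintype.card I * 4) + 1) (fun B => by
      have h1 := hbd _ _ (hFg B)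
      have h2 : ‖B (delta none) (delta none)‖ ≤ ‖B‖ := by
        have := B.le_opNorm₂ (delta none) (delta none)
        simpa [norm_delta] using this
      calc ‖M (Fg B) + B (delta none) (delta none)‖ ≤ _ := norm_add_le _ _
        _ ≤ 2 * (Fintype.card I * (‖B‖ * 4)) + ‖B‖ := add_le_add h1 h2
        _ = _ := by ring)
  have hVap : ∀ B, V B = M (Fg B) + B (delta none) (delta none) := fun B => rfl
  refine amenable_of_virtual mul u hul hur V ?_ ?_
  · intro B B₁ B₂ c h1 h2
    let L₁ : L1 (Brandt I G) →L[ℂ] ℂ := (V.comp (ContinuousLinearMap.compL ℂ _ _ _ B)).comp mul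
    let Q := ((ContinuousLinearMap.compL ℂ (L1 (Brandt I G)) (L1 (Brandt I G)) ℂ).flip).comp mul.flip
    let L₂ : L1 (Brandt I G) →L[ℂ] ℂ := V.comp
      (((ContinuousLinearMap.compL ℂ (L1 (Brandt I G)) (L1 (Brandt I G) →L[ℂ] ℂ)
        (L1 (Brandt I G) →L[ℂ] ℂ)).flip B).comp Q)
    have hL₁ : ∀ c, L₁ c = M (fun g => ∑ i : I, B (mul c (eps i g i0)) (eps i0 g⁻¹ i)) +
      B (mul c (delta none)) (delta none) := fun c => rfl
    have hL₂ : ∀ c, L₂ c = M (fun g => ∑ i : I, B (eps i g i0) (mul (eps i0 g⁻¹ i) c)) +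
      B (delta none) (mul (delta none) c) := fun c => rfl
    have hB₁ : V B₁ = L₁ c := by
      rw [hVap, hL₁, h1]
      congr 2
      funext g
      exact Finset.sum_congr rfl fun i _ => h1 _ _
    have hB₂ : V B₂ = L₂ c := by
      rw [hVap, hL₂, h2]
      congr 2
      funext g
      exact Finset.sum_congr rfl fun i _ => h2 _ _
    rw [hB₁, hB₂]
    refine congrArg (fun F : _ →L[ℂ] ℂ => F c) (hA L₁ L₂ (fun k h l => ?_) ?_)
    · rw [hL₁, hL₂, eps_mul_none, none_mul_eps]
      have e1 : (fun g => ∑ i : I, B (mul (eps k h l) (eps i g i0)) (eps i0 g⁻¹ i)) =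
          fun g => B (eps k (h * g) i0) (eps i0 g⁻¹ l) := by
        funext g
        rw [Finset.sum_eq_single l, eps_mul_same]
        · intro b _ hb
          rw [eps_mul_ne _ _ hb.symm]; simp
        · simp
      have e2 : (fun g => ∑ i : I, B (eps i g i0) (mul (eps i0 g⁻¹ i) (eps k h l))) =
          fun g => B (eps k g i0) (eps i0 (g⁻¹ * h) l) := by
        funext g
        rw [Finset.sum_eq_single k, eps_mul_same]
        · intro b _ hb
          rw [eps_mul_ne _ _ hb]; simp
        · simp
      rw [e1, e2]
      have := hinv h (fun g => B (eps k g i0) (eps i0 (g⁻¹ * h) l)) (‖B‖ * 4)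
        (fun g => hB0 _ _ _ _ _ _ _)
      rw [← this]
      simp
    · rw [hL₁, hL₂, none_mul_none]
      congr 2
      funext g
      refine Finset.sum_congr rfl fun i _ => ?_
      rw [eps_mul_none, none_mul_eps]; simp
  · intro B f h
    rw [hVap, h, none_mul_none]
    have : Fg B = fun _ => f (∑ i : I, eps i 1 i) := by
      funext g
      rw [map_sum]
      refine Finset.sum_congr rfl fun i _ => ?_
      rw [h, eps_mul_same, mul_inv_cancel]
    rw [this, hconst, hu, map_add]

end Amen



/-! ### Failure of approximate amenability for infinite index sets -/

section NonAA

variable {J G : Type}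

/-- The index space of the predual module. -/
inductive YY (J : Type) : Type
  | zero : YY J
  | fin (i k : J) : YY J
  | left (i : J) : YY J
  | right (k : J) : YY J

instance : TopologicalSpace (YY J) := ⊥
instance : DiscreteTopology (YY J) := ⟨rfl⟩

open Classical in
/-- Left action on the index space. -/
def lact : Brandt J G → YY J → YY J
  | some (p, _, q), .fin i k => if q = i then .fin p k else .zero
  | some (p, _, q), .left i => if q = i then .left p else .zero
  | some (p, _, _), .right k => .fin p k
  | some _, .zero => .zero
  | none, _ => .zero

open Classical in
/-- Right action on the index space. -/
def ract : YY J → Brandt J G → YY J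
  | .fin i k, some (p, _, q) => if k = p then .fin i q else .zero
  | .right k, some (p, _, q) => if k = p then .right q else .zero
  | .left i, some (_, _, q) => .fin i q
  | .zero, some _ => .zero
  | _, none => .zero

lemma lact_zero (s : Brandt J G) : lact s .zero = .zero := by
  rcases s with _ | ⟨i, g, j⟩ <;> rfl

lemma lact_none (y : YY J) : lact (none : Brandt J G) y = .zero := by
  cases y <;> rfl

lemma ract_zero (s : Brandt J G) : ract .zero s = .zero := by
  rcases s with _ | ⟨i, g, j⟩ <;> rfl

lemma ract_none (y : YY J) : ract y (none : Brandt J G) = .zero := by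
  cases y <;> rfl

lemma lact_lact [Group G] (s t : Brandt J G) (y : YY J) : lact s (lact t y) = lact (rmul s t) y := by
  classical
  rcases t with _ | ⟨p', h, q'⟩
  · rw [lact_none, rmul_none_right, lact_none, lact_zero]
  rcases s with _ | ⟨p, g, q⟩
  · rw [lact_none, rmul_none_left, lact_none]
  rw [rmul_some]
  cases y <;> by_cases h1 : q = p' <;> simp [lact, h1] <;> split_ifs <;> simp [lact, *]

lemma ract_ract [Group G] (s t : Brandt J G) (y : YY J) : ract (ract y s) t = ract y (rmul s t) := by
  classical
  rcases s with _ | ⟨p, g, q⟩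
  · rw [ract_none, rmul_none_left, ract_none, ract_zero]
  rcases t with _ | ⟨p', h, q'⟩
  · rw [ract_none, rmul_none_right, ract_none]
  rw [rmul_some]
  cases y <;> by_cases h1 : q = p' <;> simp [ract, h1] <;> split_ifs <;> simp [ract, *]

lemma lact_ract (s t : Brandt J G) (y : YY J) : ract (lact s y) t = lact s (ract y t) := by
  classical
  rcases s with _ | ⟨p, g, q⟩
  · rw [lact_none, lact_none, ract_zero]
  rcases t with _ | ⟨p', h, q'⟩
  · rw [ract_none, ract_none, lact_zero]
  cases y <;> simp [ract, lact] <;> split_ifs <;> simp [ract, lact, *]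

/-- The predual module. -/
abbrev EE (J : Type) : Type := BoundedContinuousFunction (YY J) ℂ

/-- Composition operator on the predual module. -/
def compop (φ : YY J → YY J) : EE J →L[ℂ] EE J :=
  LinearMap.mkContinuous
    { toFun := fun x => x.compContinuous ⟨φ, continuous_of_discreteTopology⟩
      map_add' := fun x y => rfl
      map_smul' := fun c x => rfl } 1
    (fun x => by
      rw [one_mul]
      exact BoundedContinuousFunction.norm_compContinuous_le _ _)

lemma compop_apply (φ : YY J → YY J) (x : EE J) (y : YY J) : compop φ x y = x (φ y) := rfl

lemma norm_compop (φ : YY J → YY J) : ‖compop φ‖ ≤ 1 :=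
  LinearMap.mkContinuous_norm_le _ zero_le_one _

/-- Left module action. -/
def lmod (J G : Type) : L1 (Brandt J G) →L[ℂ] EE J →L[ℂ] EE J :=
  l1lift (fun s => compop (fun y => ract y s)) 1 (fun _ => norm_compop _)

/-- Right module action, flipped. -/
def rmodf (J G : Type) : L1 (Brandt J G) →L[ℂ] EE J →L[ℂ] EE J :=
  l1lift (fun s => compop (fun y => lact s y)) 1 (fun _ => norm_compop _)

/-- The values of the derivation on point masses. -/
def dval : Brandt J G → (EE J →L[ℂ] ℂ)
  | some (p, _, q) => BoundedContinuousFunction.evalCLM ℂ (YY.left p)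
      - BoundedContinuousFunction.evalCLM ℂ (YY.right q)
  | none => 0

lemma norm_evalCLM (y : YY J) :
    ‖(BoundedContinuousFunction.evalCLM ℂ y : EE J →L[ℂ] ℂ)‖ ≤ 1 :=
  ContinuousLinearMap.opNorm_le_bound _ zero_le_one
    (fun x => by rw [one_mul]; exact x.norm_coe_le_norm y)

lemma norm_dval (s : Brandt J G) : ‖dval s‖ ≤ 2 := by
  rcases s with _ | ⟨p, g, q⟩
  · simp [dval]
  · refine (norm_sub_le _ _).trans ?_
    have := norm_evalCLM (YY.left p)
    have := norm_evalCLM (YY.right q)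
    linarith

/-- The derivation. -/
def dder (J G : Type) : L1 (Brandt J G) →L[ℂ] (EE J →L[ℂ] ℂ) := l1lift dval 2 norm_dval

lemma lmod_delta (s : Brandt J G) (x : EE J) (y : YY J) :
    lmod J G (delta s) x y = x (ract y s) := by
  rw [lmod, l1lift_delta]; rfl

lemma rmodf_delta (s : Brandt J G) (x : EE J) (y : YY J) :
    rmodf J G (delta s) x y = x (lact s y) := by
  rw [rmodf, l1lift_delta]; rfl

lemma dder_some (p q : J) (g : G) (x : EE J) :
    dder J G (delta (some (p, g, q))) x = x (.left p) - x (.right q) := by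
  rw [dder, l1lift_delta]; rfl

lemma dder_none (x : EE J) :
    dder J G (delta none) x = 0 := by
  rw [dder, l1lift_delta]; rfl

lemma l1_eq_of {X V : Type} [NormedAddCommGroup V] [NormedSpace ℂ V]
    (f g : L1 X →L[ℂ] V) (h : ∀ x, f (delta x) = g (delta x)) (a) : f a = g a := by
  rw [l1_ext h]

lemma lmod_mul [Group G] (a b : L1 (Brandt J G)) (x : EE J) :
    lmod J G (rconv J J J G a b) x = lmod J G a (lmod J G b x) := by
  refine l1_eq_of (((lmod J G).flip x).comp ((rconv J J J G).flip b))
    ((lmod J G).flip (lmod J G b x)) (fun s => ?_) a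
  refine l1_eq_of (((lmod J G).flip x).comp (rconv J J J G (delta s)))
    ((lmod J G (delta s)).comp ((lmod J G).flip x)) (fun t => ?_) b
  simp only [ContinuousLinearMap.comp_apply, ContinuousLinearMap.flip_apply, rconv_delta]
  ext y
  rw [lmod_delta, lmod_delta, lmod_delta, ract_ract]

lemma rmodf_mul [Group G] (a b : L1 (Brandt J G)) (x : EE J) :
    rmodf J G b (rmodf J G a x) = rmodf J G (rconv J J J G a b) x := by
  refine l1_eq_of ((rmodf J G b).comp ((rmodf J G).flip x))
    (((rmodf J G).flip x).comp ((rconv J J J G).flip b)) (fun s => ?_) a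
  refine l1_eq_of ((rmodf J G).flip (rmodf J G (delta s) x))
    (((rmodf J G).flip x).comp (rconv J J J G (delta s))) (fun t => ?_) b
  simp only [ContinuousLinearMap.comp_apply, ContinuousLinearMap.flip_apply, rconv_delta]
  ext y
  rw [rmodf_delta, rmodf_delta, rmodf_delta, lact_lact]

lemma lmod_rmodf [Group G] (a b : L1 (Brandt J G)) (x : EE J) :
    rmodf J G b (lmod J G a x) = lmod J G a (rmodf J G b x) := by
  refine l1_eq_of ((rmodf J G b).comp ((lmod J G).flip x))
    ((lmod J G).flip (rmodf J G b x)) (fun s => ?_) a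
  refine l1_eq_of ((rmodf J G).flip (lmod J G (delta s) x))
    ((lmod J G (delta s)).comp ((rmodf J G).flip x)) (fun t => ?_) b
  simp only [ContinuousLinearMap.comp_apply, ContinuousLinearMap.flip_apply]
  ext y
  rw [rmodf_delta, lmod_delta, lmod_delta, rmodf_delta, lact_ract]

lemma dder_mul [Group G] (a b : L1 (Brandt J G)) :
    dder J G (rconv J J J G a b)
      = (dder J G b).comp (rmodf J G a) + (dder J G a).comp (lmod J G b) := by
  classical
  ext x
  refine l1_eq_of (((dder J G).flip x).comp ((rconv J J J G).flip b))
    ((dder J G b).comp ((rmodf J G).flip x) + (dder J G).flip (lmod J G b x)) (fun s => ?_) a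
  refine l1_eq_of (((dder J G).flip x).comp (rconv J J J G (delta s)))
    ((dder J G).flip (rmodf J G (delta s) x) + (dder J G (delta s)).comp ((lmod J G).flip x))
    (fun t => ?_) b
  simp only [ContinuousLinearMap.comp_apply, 
    ContinuousLinearMap.flip_apply, ContinuousLinearMap.add_apply, rconv_delta]
  rcases s with _ | ⟨p, g, q⟩
  · rw [rmul_none_left]
    rcases t with _ | ⟨p', h, q'⟩
    · simp only [dder_none, add_zero]
    · simp only [dder_none, add_zero, dder_some, rmodf_delta, lact_none, sub_self]
  rcases t with _ | ⟨p', h, q'⟩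
  · rw [rmul_none_right]
    simp only [dder_none, add_zero, dder_some, lmod_delta, ract_none, sub_self]
  rw [rmul_some]
  by_cases h1 : q = p' <;>
    simp [h1, dder_some, dder_none, lmod_delta, rmodf_delta, lact, ract]

end NonAA


section Quant

variable {J G : Type}

/-- Blocks of sizes `4 ^ b`. -/
abbrev WW : Type := Σ b : ℕ, Fin (4 ^ b)

lemma block_hasSum {F : WW → ℂ} (b : ℕ) (h : ∀ σ : WW, σ.1 ≠ b → F σ = 0) :
    HasSum F (∑ j, F ⟨b, j⟩) := by
  have := hasSum_sum_of_ne_finset_zero (f := F)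
    (s := Finset.univ.map (Function.Embedding.sigmaMk b)) (L := SummationFilter.unconditional _)
    (by
      rintro ⟨b', j⟩ hσ
      apply h
      intro hb
      simp only at hb
      subst hb
      exact hσ (by simp))
  simpa using this

/-- A block-constant element of `ℓ¹`. -/
def coefElt (c : ℕ → ℝ) (h : Summable (fun b => |c b| * 4 ^ b)) : L1 WW :=
  ⟨fun σ => (c σ.1 : ℂ), by
    refine memℓp_gen ?_
    simp only [ENNReal.toReal_one, Real.rpow_one]
    rw [summable_sigma_of_nonneg (fun _ => norm_nonneg _)]
    refine ⟨fun b => (hasSum_fintype _).summable, ?_⟩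
    refine h.congr fun b => ?_
    simp [mul_comm]⟩

lemma coefElt_apply (c : ℕ → ℝ) (h) (σ : WW) : coefElt c h σ = (c σ.1 : ℂ) := rfl

/-- The diagonal elements of the Brandt algebra. -/
def diagElt [Group G] (e : WW → J) (c : ℕ → ℝ) (h : Summable (fun b => |c b| * 4 ^ b)) :
    L1 (Brandt J G) :=
  l1lift (fun σ => delta (some (e σ, 1, e σ))) 1 (fun _ => (norm_delta _).le) (coefElt c h)

lemma diagElt_hasSum [Group G] (e : WW → J) (c : ℕ → ℝ) (h) {V : Type} [NormedAddCommGroup V]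
    [NormedSpace ℂ V] (T : L1 (Brandt J G) →L[ℂ] V) :
    HasSum (fun σ => (c σ.1 : ℂ) • T (delta (some (e σ, 1, e σ)))) (T (diagElt e c h)) := by
  have := (l1lift_hasSum (fun σ => (delta (some (e σ, 1, e σ)) : L1 (Brandt J G))) 1
    (fun _ => (norm_delta _).le) (coefElt c h)).mapL T
  simp only [map_smul, coefElt_apply] at this
  exact this

lemma diagElt_block [Group G] (e : WW → J) (c : ℕ → ℝ) (h)
    (T : L1 (Brandt J G) →L[ℂ] ℂ) (b : ℕ)
    (hT : ∀ σ : WW, σ.1 ≠ b → T (delta (some (e σ, 1, e σ))) = 0) :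
    T (diagElt e c h) = (c b : ℂ) * ∑ j, T (delta (some (e ⟨b, j⟩, 1, e ⟨b, j⟩))) := by
  have h1 := diagElt_hasSum e c h T
  have h2 := block_hasSum (F := fun σ => (c σ.1 : ℂ) • T (delta (some (e σ, 1, e σ)))) b
    (fun σ hσ => by rw [hT σ hσ, smul_zero])
  rw [h1.unique h2, Finset.mul_sum]
  rfl

open Classical in
/-- Indicator functions. -/
def indf (S : Set (YY J)) : EE J :=
  BoundedContinuousFunction.ofNormedAddCommGroup (fun y => if y ∈ S then (1 : ℂ) else 0)
    continuous_of_discreteTopology 1 (fun y => by split_ifs <;> simp)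

open Classical in
lemma indf_apply (S : Set (YY J)) (y : YY J) : indf S y = if y ∈ S then (1 : ℂ) else 0 := rfl

lemma norm_indf_le (S : Set (YY J)) : ‖indf S‖ ≤ 1 :=
  BoundedContinuousFunction.norm_ofNormedAddCommGroup_le _ zero_le_one _

/-- The block `b` as a subset of `J`. -/
def blk (e : WW → J) (b : ℕ) : Set J := {i | ∃ j, e ⟨b, j⟩ = i}

lemma mem_blk {e : WW → J} (he : Function.Injective e) (b : ℕ) (σ : WW) :
    e σ ∈ blk e b ↔ σ.1 = b := by
  constructor
  · rintro ⟨j, hj⟩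
    rw [← he hj]
  · rintro rfl
    exact ⟨σ.2, rfl⟩

/-- The rectangle. -/
def rect (h k : Set J) : Set (YY J) := {y | ∃ i ∈ h, ∃ j ∈ k, y = .fin i j}

/-- Left and right. -/
def lset (h : Set J) : Set (YY J) := {y | ∃ i ∈ h, y = .left i}
/-- Right. -/
def rset (h : Set J) : Set (YY J) := {y | ∃ i ∈ h, y = .right i}

lemma rmodf_rect (h k : Set J) (p : J) (g : G) (hp : p ∈ h) :
    rmodf J G (delta (some (p, g, p))) (indf (rect h k))
      = indf (rect {p} k) + indf (rset k) := by
  classical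
  ext y
  rw [rmodf_delta, BoundedContinuousFunction.add_apply]
  simp only [indf_apply]
  cases y with
  | zero => simp [lact, rect, rset]
  | fin i j =>
    by_cases hi : p = i
    · subst hi; simp [lact, rect, rset, hp]
    · simp [lact, rect, rset, hi, Ne.symm hi]
  | left i =>
    by_cases hi : p = i <;> simp [lact, rect, rset, hi]
  | right i => simp [lact, rect, rset, hp]

lemma rmodf_rect' (h k : Set J) (p : J) (g : G) (hp : p ∉ h) :
    rmodf J G (delta (some (p, g, p))) (indf (rect h k)) = 0 := by
  classical
  ext y
  rw [rmodf_delta]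
  simp only [indf_apply]
  cases y with
  | zero => simp [lact, rect]
  | fin i j => by_cases hi : p = i <;> simp [lact, rect, hp, hi] ; subst hi; simp [hp]
  | left i => by_cases hi : p = i <;> simp [lact, rect, hi]
  | right i => simp [lact, rect, hp]

lemma lmod_rect (h k : Set J) (p : J) (g : G) (hp : p ∈ k) :
    lmod J G (delta (some (p, g, p))) (indf (rect h k))
      = indf (rect h {p}) + indf (lset h) := by
  classical
  ext y
  rw [lmod_delta, BoundedContinuousFunction.add_apply]
  simp only [indf_apply]
  cases y with
  | zero => simp [ract, rect, lset]
  | fin i j =>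
    by_cases hi : j = p
    · subst hi; simp [ract, rect, lset, hp]
    · simp [ract, rect, lset, hi]
  | right i =>
    by_cases hi : i = p <;> simp [ract, rect, lset, hi]
  | left i => simp [ract, rect, lset, hp]

lemma lmod_rect' (h k : Set J) (p : J) (g : G) (hp : p ∉ k) :
    lmod J G (delta (some (p, g, p))) (indf (rect h k)) = 0 := by
  classical
  ext y
  rw [lmod_delta]
  simp only [indf_apply]
  cases y with
  | zero => simp [ract, rect]
  | fin i j => by_cases hi : j = p <;> simp [ract, rect, hp, hi]
  | right i => by_cases hi : i = p <;> simp [ract, rect, hi]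
  | left i => simp [ract, rect, hp]

lemma sum_rect_left {e : WW → J} (he : Function.Injective e) (b : ℕ) (k : Set J) :
    ∑ j, indf (rect {e ⟨b, j⟩} k) = indf (rect (blk e b) k) := by
  classical
  ext y
  rw [BoundedContinuousFunction.sum_apply]
  simp only [indf_apply]
  by_cases hy : y ∈ rect (blk e b) k
  · rw [if_pos hy]
    obtain ⟨i, ⟨j, rfl⟩, i', hi', rfl⟩ := hy
    rw [Finset.sum_eq_single j, if_pos ⟨_, rfl, _, hi', rfl⟩]
    · rintro j' _ hj'
      rw [if_neg]
      rintro ⟨_, rfl, _, _, h⟩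
      simp only [YY.fin.injEq] at h
      have := he h.1
      simp only [Sigma.mk.injEq, heq_eq_eq, true_and] at this
      exact hj' this.symm
    · simp
  · rw [if_neg hy]
    refine Finset.sum_eq_zero fun j _ => ?_
    rw [if_neg]
    rintro ⟨_, rfl, i', hi', rfl⟩
    exact hy ⟨_, ⟨j, rfl⟩, _, hi', rfl⟩

lemma sum_rect_right {e : WW → J} (he : Function.Injective e) (b : ℕ) (h : Set J) :
    ∑ j, indf (rect h {e ⟨b, j⟩}) = indf (rect h (blk e b)) := by
  classical
  ext y
  rw [BoundedContinuousFunction.sum_apply]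
  simp only [indf_apply]
  by_cases hy : y ∈ rect h (blk e b)
  · rw [if_pos hy]
    obtain ⟨i', hi', i, ⟨j, rfl⟩, rfl⟩ := hy
    rw [Finset.sum_eq_single j, if_pos ⟨_, hi', _, rfl, rfl⟩]
    · rintro j' _ hj'
      rw [if_neg]
      rintro ⟨_, _, _, rfl, h⟩
      simp only [YY.fin.injEq] at h
      have := he h.2
      simp only [Sigma.mk.injEq, heq_eq_eq, true_and] at this
      exact hj' this.symm
    · simp
  · rw [if_neg hy]
    refine Finset.sum_eq_zero fun j _ => ?_
    rw [if_neg]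
    rintro ⟨i', hi', _, rfl, rfl⟩
    exact hy ⟨_, hi', _, ⟨j, rfl⟩, rfl⟩

variable [Group G]

lemma test_rect {e : WW → J} (he : Function.Injective e) (c : ℕ → ℝ) (hc)
    (f : EE J →L[ℂ] ℂ) (b b' : ℕ) (hbb : c b = c b') :
    (f.comp (rmodf J G (diagElt e c hc)) - f.comp (lmod J G (diagElt e c hc))
      - dder J G (diagElt e c hc)) (indf (rect (blk e b) (blk e b')))
    = (c b : ℂ) * (4 ^ b * f (indf (rset (blk e b'))) - 4 ^ b' * f (indf (lset (blk e b)))) := by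
  classical
  set x := indf (rect (blk e b) (blk e b')) with hx
  have h1 : f (rmodf J G (diagElt e c hc) x)
      = (c b : ℂ) * (f x + 4 ^ b * f (indf (rset (blk e b')))) := by
    refine (diagElt_block e c hc (f.comp ((rmodf J G).flip x)) b (fun σ hσ => ?_)).trans ?_
    · simp only [ContinuousLinearMap.comp_apply, ContinuousLinearMap.flip_apply]
      rw [hx, rmodf_rect', map_zero]
      rwa [mem_blk he]
    · congr 1
      simp only [ContinuousLinearMap.comp_apply, ContinuousLinearMap.flip_apply]
      rw [← map_sum, hx,
        Finset.sum_congr rfl (fun j _ => rmodf_rect _ _ _ _ ((mem_blk he b _).2 rfl)),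
        Finset.sum_add_distrib, sum_rect_left he, map_add,
        Finset.sum_const, map_nsmul, nsmul_eq_mul]
      simp
  have h2 : f (lmod J G (diagElt e c hc) x)
      = (c b : ℂ) * (f x + 4 ^ b' * f (indf (lset (blk e b)))) := by
    rw [hbb]
    refine (diagElt_block e c hc (f.comp ((lmod J G).flip x)) b' (fun σ hσ => ?_)).trans ?_
    · simp only [ContinuousLinearMap.comp_apply, ContinuousLinearMap.flip_apply]
      rw [hx, lmod_rect', map_zero]
      rwa [mem_blk he]
    · congr 1
      simp only [ContinuousLinearMap.comp_apply, ContinuousLinearMap.flip_apply]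
      rw [← map_sum, hx,
        Finset.sum_congr rfl (fun j _ => lmod_rect _ _ _ _ ((mem_blk he b' _).2 rfl)),
        Finset.sum_add_distrib, sum_rect_right he, map_add,
        Finset.sum_const, map_nsmul, nsmul_eq_mul]
      simp
  have h3 : dder J G (diagElt e c hc) x = 0 := by
    have hz : ∀ σ : WW, (dder J G).flip x (delta (some (e σ, 1, e σ))) = 0 := fun σ => by
      rw [ContinuousLinearMap.flip_apply, dder_some, hx]
      simp [indf_apply, rect]
    refine (diagElt_block e c hc ((dder J G).flip x) b (fun σ hσ => hz σ)).trans ?_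
    simp [hz]
  simp only [ContinuousLinearMap.sub_apply, ContinuousLinearMap.comp_apply]
  rw [h1, h2, h3]
  ring

lemma test_left {e : WW → J} (he : Function.Injective e) (c : ℕ → ℝ) (hc)
    (f : EE J →L[ℂ] ℂ) (hc0 : c 0 = 1) :
    (f.comp (rmodf J G (diagElt e c hc)) - f.comp (lmod J G (diagElt e c hc))
      - dder J G (diagElt e c hc)) (indf (lset (blk e 0)))
    = f (indf (lset (blk e 0))) - 1 := by
  classical
  set x := indf (lset (blk e 0)) with hx
  have hsub : ∀ σ : WW, σ.1 = 0 → ∀ i ∈ blk e 0, e σ = i := by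
    rintro ⟨b, j⟩ h i ⟨j', rfl⟩
    simp only at h
    subst h
    congr 2
    exact Subsingleton.elim (α := Fin 1) _ _
  have h1 : f (rmodf J G (diagElt e c hc) x) = f x := by
    refine (diagElt_block e c hc (f.comp ((rmodf J G).flip x)) 0 (fun σ hσ => ?_)).trans ?_
    · simp only [ContinuousLinearMap.comp_apply, ContinuousLinearMap.flip_apply]
      have hn : e σ ∉ blk e 0 := by rwa [mem_blk he]
      have : rmodf J G (delta (some (e σ, 1, e σ))) x = 0 := by
        ext y
        rw [rmodf_delta, hx, indf_apply, if_neg]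
        · rfl
        rintro ⟨i, hi, h⟩
        cases y <;> simp only [lact] at h <;> (try split_ifs at h) <;>
          simp only [YY.left.injEq, reduceCtorEq] at h
        exact hn (h ▸ hi)
      rw [this, map_zero]
    · rw [hc0, Complex.ofReal_one, one_mul]
      have : ∀ j : Fin (4 ^ 0), rmodf J G (delta (some (e ⟨0, j⟩, 1, e ⟨0, j⟩))) x = x := by
        intro j
        ext y
        rw [rmodf_delta, hx]
        simp only [indf_apply]
        cases y with
        | zero => rfl
        | fin i k => by_cases h : e ⟨0, j⟩ = i <;> simp [lact, lset, h]
        | right i => simp [lact, lset]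
        | left i =>
          by_cases h : e ⟨0, j⟩ = i
          · simp [lact, h]
          · have : i ∉ blk e 0 := fun hi => h (hsub _ rfl i hi)
            simp [lact, h, lset, this]
      simp [this]
  have h2 : f (lmod J G (diagElt e c hc) x) = 0 := by
    have hz : ∀ σ : WW, lmod J G (delta (some (e σ, 1, e σ))) x = 0 := fun σ => by
      ext y
      rw [lmod_delta, hx, indf_apply, if_neg]
      · rfl
      rintro ⟨i, hi, h⟩
      cases y <;> simp only [ract] at h <;> (try split_ifs at h) <;>
        simp only [reduceCtorEq] at h
    refine (diagElt_block e c hc (f.comp ((lmod J G).flip x)) 0 (fun σ hσ => ?_)).trans ?_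
    · simp [hz]
    · simp [hz]
  have h3 : dder J G (diagElt e c hc) x = 1 := by
    have hz : ∀ p, dder J G (delta (some (p, (1 : G), p))) x
        = if p ∈ blk e 0 then 1 else 0 := fun p => by
      rw [dder_some, hx]
      simp [indf_apply, lset]
    refine (diagElt_block e c hc ((dder J G).flip x) 0 (fun σ hσ => ?_)).trans ?_
    · rw [ContinuousLinearMap.flip_apply, hz, if_neg]
      rwa [mem_blk he]
    · simp only [ContinuousLinearMap.flip_apply, hz, mem_blk he]
      simp [hc0]
  simp only [ContinuousLinearMap.sub_apply, ContinuousLinearMap.comp_apply]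
  rw [h1, h2, h3]
  ring

end Quant


section Final

lemma seq_bound (U V : ℕ → ℂ) (M ε : ℝ) (hM : ∀ b, ‖U b‖ ≤ M)
    (h : ∀ b, ∃ α : ℝ, (1 / 8 : ℝ) ^ (b + 1) ≤ α ∧
      ‖(α : ℂ) * (4 ^ b * V (b + 1) - 4 ^ (b + 1) * U b)‖ ≤ ε ∧
      ‖(α : ℂ) * (4 ^ (b + 1) * V (b + 1) - 4 ^ (b + 1) * U (b + 1))‖ ≤ ε) :
    ‖U 0‖ ≤ 6 * ε := by
  have hε : 0 ≤ ε := by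
    obtain ⟨α, _, h1, _⟩ := h 0
    exact (norm_nonneg _).trans h1
  have key : ∀ (α : ℝ) (b : ℕ) (z : ℂ), (1 / 8 : ℝ) ^ (b + 1) ≤ α → ‖(α : ℂ) * z‖ ≤ ε →
      ‖z‖ ≤ ε * 8 ^ (b + 1) := by
    intro α b z hα hz
    have hp : (0 : ℝ) < (1 / 8 : ℝ) ^ (b + 1) := by positivity
    rw [norm_mul, Complex.norm_real, Real.norm_of_nonneg (hp.le.trans hα)] at hz
    have h1 : (1 / 8 : ℝ) ^ (b + 1) * ‖z‖ ≤ ε :=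
      (mul_le_mul_of_nonneg_right hα (norm_nonneg _)).trans hz
    rw [one_div, inv_pow, inv_mul_le_iff₀ (by positivity)] at h1
    linarith
  have step : ∀ b, ‖U b / 4 ^ b - U (b + 1) / 4 ^ (b + 1)‖ ≤ 3 * ε * (1 / 2) ^ b := by
    intro b
    obtain ⟨α, hα, h1, h2⟩ := h b
    have k1 := key α b _ hα h1
    have k2 := key α b _ hα h2
    set X := 4 ^ b * V (b + 1) - 4 ^ (b + 1) * U b with hX
    set Z := 4 ^ (b + 1) * V (b + 1) - 4 ^ (b + 1) * U (b + 1) with hZ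
    have e : U b / 4 ^ b - U (b + 1) / 4 ^ (b + 1) = (Z / 16 - X / 4) / 16 ^ b := by
      have h16 : (16 : ℂ) ^ b = 4 ^ b * 4 ^ b := by rw [← mul_pow]; norm_num
      have h4 : (4 : ℂ) ^ b ≠ 0 := pow_ne_zero _ (by norm_num)
      rw [hX, hZ, h16, pow_succ]
      field_simp
      ring
    rw [e, norm_div, norm_pow, div_le_iff₀ (by simp)]
    have h5 : (1 / 2 : ℝ) ^ b * 16 ^ b = 8 ^ b := by rw [← mul_pow]; norm_num
    have h6 : ‖(16 : ℂ)‖ = 16 := by simp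
    rw [h6, mul_assoc, h5]
    have h7 : ‖Z / 16 - X / 4‖ ≤ ‖Z‖ / 16 + ‖X‖ / 4 := by
      refine (norm_sub_le _ _).trans ?_
      simp [norm_div]
    have h8 : 0 ≤ ε * 8 ^ b := by positivity
    rw [pow_succ] at k1 k2
    linarith
  have tel : ∀ n, ‖U 0‖ ≤ ‖U n / 4 ^ n‖ + 6 * ε * (1 - (1 / 2) ^ n) := by
    intro n
    induction n with
    | zero => simp
    | succ n ih =>
      have h1 := step n
      have h2 := norm_sub_norm_le (U n / 4 ^ n) (U (n + 1) / 4 ^ (n + 1))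
      rw [pow_succ (1 / 2 : ℝ)]
      linarith
  have lim : Tendsto (fun n : ℕ => M * (1 / 4 : ℝ) ^ n + 6 * ε) atTop (nhds (M * 0 + 6 * ε)) :=
    ((tendsto_pow_atTop_nhds_zero_of_lt_one (by norm_num) (by norm_num)).const_mul M).add_const _
  rw [mul_zero, zero_add] at lim
  refine ge_of_tendsto' lim fun n => (tel n).trans ?_
  have h1 : ‖U n / 4 ^ n‖ ≤ M * (1 / 4) ^ n := by
    rw [norm_div, norm_pow, div_eq_mul_inv, one_div, inv_pow]
    simp only [Complex.norm_ofNat]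
    exact mul_le_mul_of_nonneg_right (hM n) (by positivity)
  have h2 : 0 ≤ ε * (1 / 2) ^ n := by positivity
  linarith

/-- First coefficient family. -/
def cA (b : ℕ) : ℝ := (1 / 64) ^ (b / 2)
/-- Second coefficient family. -/
def cB (b : ℕ) : ℝ := (1 / 64) ^ ((b + 1) / 2)

lemma coef_summable (k : ℕ → ℕ) (hk : ∀ b, b ≤ 2 * k b + 1) :
    Summable (fun b => |(1 / 64 : ℝ) ^ k b| * 4 ^ b) := by
  have hs : Summable (fun b : ℕ => 8 * (1 / 2 : ℝ) ^ b) :=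
    (summable_geometric_of_lt_one (by norm_num) (by norm_num)).mul_left 8
  refine Summable.of_nonneg_of_le (fun b => by positivity) (fun b => ?_) hs
  rw [abs_of_nonneg (by positivity)]
  have h1 : (1 / 64 : ℝ) ^ k b = (1 / 8) ^ (2 * k b) := by rw [pow_mul]; norm_num
  have h2 : (1 / 8 : ℝ) ^ (2 * k b + 1) ≤ (1 / 8) ^ b :=
    pow_le_pow_of_le_one (by norm_num) (by norm_num) (hk b)
  have h3 : (1 / 8 : ℝ) ^ b * 4 ^ b = (1 / 2) ^ b := by rw [← mul_pow]; norm_num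
  rw [pow_succ] at h2
  have h4 : (0 : ℝ) < 4 ^ b := by positivity
  rw [h1, ← h3]
  nlinarith

lemma cA_summable : Summable (fun b => |cA b| * 4 ^ b) :=
  coef_summable (fun b => b / 2) (fun b => by omega)

lemma cB_summable : Summable (fun b => |cB b| * 4 ^ b) :=
  coef_summable (fun b => (b + 1) / 2) (fun b => by omega)

lemma cA_even (b : ℕ) (hb : b % 2 = 0) : cA b = cA (b + 1) ∧ (1 / 8 : ℝ) ^ (b + 1) ≤ cA b := by
  obtain ⟨k, rfl⟩ : ∃ k, b = 2 * k := ⟨b / 2, by omega⟩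
  have h1 : (2 * k) / 2 = k := by omega
  have h2 : (2 * k + 1) / 2 = k := by omega
  refine ⟨by rw [cA, cA, h1, h2], ?_⟩
  rw [cA, h1, pow_succ, pow_mul]
  have : (0 : ℝ) < (1 / 64) ^ k := by positivity
  norm_num at this ⊢

lemma cB_odd (b : ℕ) (hb : b % 2 = 1) : cB b = cB (b + 1) ∧ (1 / 8 : ℝ) ^ (b + 1) ≤ cB b := by
  obtain ⟨k, rfl⟩ : ∃ k, b = 2 * k + 1 := ⟨b / 2, by omega⟩
  have h1 : (2 * k + 1 + 1) / 2 = k + 1 := by omega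
  have h2 : (2 * k + 1 + 1 + 1) / 2 = k + 1 := by omega
  refine ⟨by rw [cB, cB, h1, h2], ?_⟩
  have h3 : 2 * k + 1 + 1 = 2 * (k + 1) := by ring
  rw [cB, h1, h3, pow_mul]
  norm_num

lemma not_approx (J G : Type) [Infinite J] [Group G] : ¬ ApproxAmenableBA (rconv J J J G) := by
  intro H
  obtain ⟨ι, F, hF, f, hf⟩ := H (EE J) (lmod J G) (rmodf J G).flip
    (fun a b x => lmod_mul a b x) (fun x a b => rmodf_mul a b x)
    (fun a x b => lmod_rmodf a b x) (dder J G) (fun a b => dder_mul a b)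
  simp only [ContinuousLinearMap.flip_flip] at hf
  obtain ⟨e0⟩ : Nonempty (ℕ ↪ J) := ⟨Infinite.natEmbedding J⟩
  obtain ⟨e1, he1⟩ := exists_injective_nat WW
  let e : WW → J := fun σ => e0 (e1 σ)
  have he : Function.Injective e := e0.injective.comp he1
  have near : ∀ a : L1 (Brandt J G), ∀ᶠ i in F, ‖(f i).comp (rmodf J G a)
      - (f i).comp (lmod J G a) - dder J G a‖ < 1 / 16 := by
    intro a
    have := (hf a).eventually (Metric.ball_mem_nhds _ (show (0 : ℝ) < 1 / 16 by norm_num))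
    filter_upwards [this] with i hi
    rwa [dist_eq_norm] at hi
  obtain ⟨i, hA, hB⟩ := ((near (diagElt e cA cA_summable)).and
    (near (diagElt e cB cB_summable))).exists
  have app : ∀ (T : EE J →L[ℂ] ℂ) (S : Set (YY J)), ‖T‖ < 1 / 16 → ‖T (indf S)‖ ≤ 1 / 16 := by
    intro T S hT
    refine (T.le_opNorm _).trans ?_
    have := norm_indf_le S
    have := norm_nonneg T
    have := norm_nonneg (indf S)
    nlinarith
  have hU0 := seq_bound (fun b => f i (indf (lset (blk e b)))) (fun b => f i (indf (rset (blk e b))))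
    ‖f i‖ (1 / 16) (fun b => by
      refine ((f i).le_opNorm _).trans ?_
      exact mul_le_of_le_one_right (norm_nonneg _) (norm_indf_le _))
    (fun b => by
      rcases Nat.mod_two_eq_zero_or_one b with hb | hb
      · obtain ⟨h1, h2⟩ := cA_even b hb
        refine ⟨cA b, h2, ?_, ?_⟩
        · rw [← test_rect (G := G) he cA cA_summable (f i) b (b + 1) h1]
          exact app _ _ hA
        · rw [h1, ← test_rect (G := G) he cA cA_summable (f i) (b + 1) (b + 1) rfl]
          exact app _ _ hA
      · obtain ⟨h1, h2⟩ := cB_odd b hb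
        refine ⟨cB b, h2, ?_, ?_⟩
        · rw [← test_rect (G := G) he cB cB_summable (f i) b (b + 1) h1]
          exact app _ _ hB
        · rw [h1, ← test_rect (G := G) he cB cB_summable (f i) (b + 1) (b + 1) rfl]
          exact app _ _ hB)
  have hl := app _ (lset (blk e 0)) hA
  rw [test_left (G := G) he cA cA_summable (f i) (by simp [cA])] at hl
  have h1 : ‖(1 : ℂ)‖ ≤ ‖f i (indf (lset (blk e 0)))‖
      + ‖f i (indf (lset (blk e 0))) - 1‖ := by
    have := norm_sub_le (f i (indf (lset (blk e 0)))) (f i (indf (lset (blk e 0))) - 1)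
    rwa [sub_sub_cancel] at this
  rw [norm_one] at h1
  linarith

lemma leftInduced_rconv (J K G : Type) [Nonempty J] [Group G] :
    LeftInduced (rconv J J J G) (rconv J J K G) := by
  intro T _ _ φ hT
  exact tensor_iso T φ hT

lemma rightInduced_rconv (I J G : Type) [Nonempty J] [Group G] :
    RightInduced (rconv J J J G) (rconv I J J G) := by
  intro T _ _ φ hT
  exact tensor_iso T φ hT

lemma selfInduced_rconv (J G : Type) [Nonempty J] [Group G] :
    SelfInduced (rconv J J J G) := by
  intro T _ _ φ hT
  obtain ⟨e, he⟩ := tensor_iso (I := J) (K := J) T φ hT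
  refine ⟨e, he, fun c a b => ?_, fun a b c => ?_⟩
  · rw [he, he, rconv_assoc]
  · rw [he, he, rconv_assoc]

lemma morita_rconv (I J G : Type) [Nonempty I] [Nonempty J] [Group G] :
    MoritaEquivalent (rconv I I I G) (rconv J J J G) :=
  ⟨{ P := L1 (Option (J × G × I))
     Q := L1 (Option (I × G × J))
     lP := rconv J J I G
     rP := rconv J I I G
     lQ := rconv I I J G
     rQ := rconv I J J G
     lawP := ⟨fun _ _ _ => rconv_assoc _ _ _, fun _ _ _ => rconv_assoc _ _ _,
       fun _ _ _ => rconv_assoc _ _ _⟩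
     lawQ := ⟨fun _ _ _ => rconv_assoc _ _ _, fun _ _ _ => rconv_assoc _ _ _,
       fun _ _ _ => rconv_assoc _ _ _⟩
     indPl := leftInduced_rconv J I G
     indPr := rightInduced_rconv J I G
     indQl := leftInduced_rconv I J G
     indQr := rightInduced_rconv I J G
     isoB := by
       intro T _ _ φ hT
       obtain ⟨e, he⟩ := tensor_iso (I := J) (J := I) (K := J) T φ hT
       refine ⟨e, fun b p q => ?_, fun b p q => ?_⟩
       · rw [he, he, rconv_assoc]
       · rw [he, he, rconv_assoc]
     isoA := by
       intro T _ _ φ hT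
       obtain ⟨e, he⟩ := tensor_iso (I := I) (J := J) (K := I) T φ hT
       refine ⟨e, fun b p q => ?_, fun b p q => ?_⟩
       · rw [he, he, rconv_assoc]
       · rw [he, he, rconv_assoc] }⟩

end Final


/-- Approximate amenability is not a Morita invariant: for an
amenable discrete group `G`, a finite nonempty set `I` and an infinite set `J`, the
algebra `ℓ¹(B(I,G))` is approximately amenable, `ℓ¹(B(J,G))` is not, yet the two
Brandt semigroup algebras are Morita equivalent self-induced Banach algebras. -/
theorem brandt_morita_stmt17 (I J G : Type) [Nonempty I] [Finite I] [Infinite J]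
    [Group G] (hG : AmenableGroup G) :
    ∃ (mulSI : L1 (Brandt I G) →L[ℂ] L1 (Brandt I G) →L[ℂ] L1 (Brandt I G))
      (mulSJ : L1 (Brandt J G) →L[ℂ] L1 (Brandt J G) →L[ℂ] L1 (Brandt J G)),
      (∀ (a b : L1 (Brandt I G)) (s : Brandt I G), mulSI a b s = l1conv a b s) ∧
      (∀ (a b : L1 (Brandt J G)) (s : Brandt J G), mulSJ a b s = l1conv a b s) ∧
      ApproxAmenableBA mulSI ∧
      ¬ ApproxAmenableBA mulSJ ∧
      SelfInduced mulSI ∧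
      SelfInduced mulSJ ∧
      MoritaEquivalent mulSI mulSJ := by
  exact ⟨rconv I I I G, rconv J J J G, rconv_apply_eq, rconv_apply_eq,
    approxAmenable_of_amenable _ (brandt_amenable hG), not_approx J G,
    selfInduced_rconv I G, selfInduced_rconv J G, morita_rconv I J G⟩
end
end

section
/- Let A be a self-induced Banach algebra. Then for every Banach A-bimodule F, the Banach A-bimodule A ⊗̂_A F ⊗̂_A A is two-sided A-induced; moreover, every two-sided A-induced Banach A-bimodule is (isomorphic to one) of this form. -/
open scoped TensorProduct BigOperators ENNReal
open Filter

noncomputable section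

/-- A Banach `A`-bimodule over the Banach algebra `(A, mulA)`. -/
structure BimodOver (A : Type) [NormedAddCommGroup A] [NormedSpace ℂ A]
    (mulA : A →L[ℂ] A →L[ℂ] A) : Type 1 where
  E : Type
  [i1 : NormedAddCommGroup E]
  [i2 : NormedSpace ℂ E]
  [i3 : CompleteSpace E]
  l : A →L[ℂ] E →L[ℂ] E
  r : E →L[ℂ] A →L[ℂ] E
  law : IsBimoduleLaw mulA mulA l r

attribute [instance] BimodOver.i1 BimodOver.i2 BimodOver.i3

section Helpers

variable {C E F T Q G : Type} [SeminormedAddCommGroup E] [NormedSpace ℂ E]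
  [SeminormedAddCommGroup F] [NormedSpace ℂ F]
  [SeminormedAddCommGroup T] [NormedSpace ℂ T]
  [SeminormedAddCommGroup Q] [NormedSpace ℂ Q]
  [SeminormedAddCommGroup G] [NormedSpace ℂ G]

theorem exists_rep (z : E ⊗[ℂ] F) : ∃ (n : ℕ) (x : Fin n → E) (y : Fin n → F),
    z = ∑ i, x i ⊗ₜ[ℂ] y i := by
  induction z using TensorProduct.induction_on with
  | zero => exact ⟨0, Fin.elim0, Fin.elim0, by simp⟩
  | tmul x y => exact ⟨1, fun _ => x, fun _ => y, by simp⟩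
  | add z w hz hw =>
    obtain ⟨n, x, y, rfl⟩ := hz
    obtain ⟨m, x', y', rfl⟩ := hw
    exact ⟨n + m, Fin.append x x', Fin.append y y', by simp [Fin.sum_univ_add]⟩

theorem projNorm_le {n : ℕ} (x : Fin n → E) (y : Fin n → F) :
    projNorm (∑ i, x i ⊗ₜ[ℂ] y i) ≤ ∑ i, ‖x i‖ * ‖y i‖ := by
  refine csInf_le ⟨0, ?_⟩ ⟨n, x, y, rfl, rfl⟩
  rintro _ ⟨n, x, y, -, rfl⟩
  positivity

theorem le_projNorm (z : E ⊗[ℂ] F) (c : ℝ)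
    (h : ∀ (n : ℕ) (x : Fin n → E) (y : Fin n → F), z = ∑ i, x i ⊗ₜ[ℂ] y i →
      c ≤ ∑ i, ‖x i‖ * ‖y i‖) : c ≤ projNorm z := by
  obtain ⟨n, x, y, hz⟩ := exists_rep z
  refine le_csInf ⟨_, n, x, y, hz, rfl⟩ ?_
  rintro _ ⟨n, x, y, hz, rfl⟩
  exact h n x y hz

theorem projNorm_nonneg (z : E ⊗[ℂ] F) : 0 ≤ projNorm z :=
  le_projNorm z 0 fun _ _ _ _ => by positivity

theorem projNorm_add (z w : E ⊗[ℂ] F) : projNorm (z + w) ≤ projNorm z + projNorm w := by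
  rw [← sub_le_iff_le_add]
  refine le_projNorm _ _ fun n x y hz => ?_
  rw [sub_le_iff_le_add, ← sub_le_iff_le_add']
  refine le_projNorm _ _ fun m x' y' hw => ?_
  rw [sub_le_iff_le_add']
  have := projNorm_le (Fin.append x x') (Fin.append y y')
  simp only [Fin.sum_univ_add, Fin.append_left, Fin.append_right] at this
  rwa [← hz, ← hw] at this

theorem projNorm_smul_le (c : ℂ) (z : E ⊗[ℂ] F) : projNorm (c • z) ≤ ‖c‖ * projNorm z := by
  by_cases hc : c = 0
  · subst hc
    have := projNorm_le (E := E) (F := F) (n := 0) Fin.elim0 Fin.elim0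
    simpa using this
  · have hc' : 0 < ‖c‖ := norm_pos_iff.2 hc
    rw [mul_comm, ← div_le_iff₀ hc']
    refine le_projNorm _ _ fun n x y hz => ?_
    rw [div_le_iff₀ hc', hz, Finset.smul_sum, Finset.sum_mul]
    have := projNorm_le (fun i => c • x i) y
    simp only [← TensorProduct.smul_tmul'] at this
    refine this.trans (le_of_eq (Finset.sum_congr rfl fun i _ => ?_))
    rw [norm_smul]; ring

theorem projNorm_smul (c : ℂ) (z : E ⊗[ℂ] F) : projNorm (c • z) = ‖c‖ * projNorm z := by
  refine le_antisymm (projNorm_smul_le c z) ?_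
  by_cases hc : c = 0
  · subst hc; simpa using projNorm_nonneg (0 : E ⊗[ℂ] F)
  · have hc' : 0 < ‖c‖ := norm_pos_iff.2 hc
    have := projNorm_smul_le c⁻¹ (c • z)
    rw [smul_smul, inv_mul_cancel₀ hc, one_smul, norm_inv] at this
    rwa [← le_inv_mul_iff₀ hc']

/-- Type synonym of the algebraic tensor product carrying the projective seminorm. -/
def PT (E F : Type) [SeminormedAddCommGroup E] [NormedSpace ℂ E]
    [SeminormedAddCommGroup F] [NormedSpace ℂ F] : Type := E ⊗[ℂ] F

instance : AddCommGroup (PT E F) := inferInstanceAs (AddCommGroup (E ⊗[ℂ] F))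
instance : Module ℂ (PT E F) := inferInstanceAs (Module ℂ (E ⊗[ℂ] F))
instance : Norm (PT E F) := ⟨fun z => projNorm (E := E) (F := F) z⟩

theorem PT_core : SeminormedSpace.Core ℂ (PT E F) where
  norm_nonneg z := projNorm_nonneg (E := E) (F := F) z
  norm_smul c z := projNorm_smul (E := E) (F := F) c z
  norm_triangle z w := projNorm_add (E := E) (F := F) z w

instance : SeminormedAddCommGroup (PT E F) := SeminormedAddCommGroup.ofCore PT_core
instance : NormedSpace ℂ (PT E F) where
  norm_smul_le c z := (projNorm_smul (E := E) (F := F) c z).le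

/-- The identity map into the synonym. -/
def toPT (E F : Type) [SeminormedAddCommGroup E] [NormedSpace ℂ E]
    [SeminormedAddCommGroup F] [NormedSpace ℂ F] : E ⊗[ℂ] F →ₗ[ℂ] PT E F := LinearMap.id

theorem exists_projTensor (E F : Type) [SeminormedAddCommGroup E] [NormedSpace ℂ E]
    [SeminormedAddCommGroup F] [NormedSpace ℂ F] :
    ∃ (T : Type) (_ : SeminormedAddCommGroup T) (_ : NormedSpace ℂ T)
      (φ : E →ₗ[ℂ] F →ₗ[ℂ] T), IsProjTensor E F T φ := by
  let ψ : E ⊗[ℂ] F →ₗ[ℂ] UniformSpace.Completion (PT E F) :=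
    (UniformSpace.Completion.toComplL (𝕜 := ℂ) (E := PT E F)).toLinearMap.comp (toPT E F)
  have hψ : TensorProduct.lift ((TensorProduct.mk ℂ E F).compr₂ ψ) = ψ := by
    ext; simp
  refine ⟨UniformSpace.Completion (PT E F), inferInstance, inferInstance,
    (TensorProduct.mk ℂ E F).compr₂ ψ, inferInstance, ?_, ?_⟩
  · intro z
    rw [hψ]
    exact UniformSpace.Completion.norm_coe (E := PT E F) z
  · rw [hψ]
    exact UniformSpace.Completion.denseRange_coe (α := PT E F)

theorem norm_lift_le (B : E →L[ℂ] F →L[ℂ] G) (z : E ⊗[ℂ] F) :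
    ‖TensorProduct.lift (B.toLinearMap₁₂) z‖ ≤ (‖B‖ + 1) * projNorm z := by
  have hC : 0 < ‖B‖ + 1 := by positivity
  rw [← div_le_iff₀' hC]
  refine le_projNorm _ _ fun n x y hz => ?_
  rw [div_le_iff₀' hC, hz, map_sum, Finset.mul_sum]
  refine (norm_sum_le _ _).trans (Finset.sum_le_sum fun i _ => ?_)
  simp only [TensorProduct.lift.tmul, ContinuousLinearMap.toLinearMap₁₂_apply]
  refine (B.le_opNorm₂ _ _).trans ?_
  rw [mul_assoc]
  gcongr
  linarith

/-- `q : E × F → Q` is universal among bounded balanced bilinear maps. -/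
structure IsBal (r : E → C → E) (l : C → F → F) (q : E →L[ℂ] F →L[ℂ] Q) : Prop where
  bal : ∀ x c y, q (r x c) y = q x (l c y)
  univ : ∀ (G : Type) [SeminormedAddCommGroup G] [NormedSpace ℂ G] [CompleteSpace G] [T2Space G]
    (B : E →L[ℂ] F →L[ℂ] G), (∀ x c y, B (r x c) y = B x (l c y)) →
    ∃ f : Q →L[ℂ] G, ∀ x y, f (q x y) = B x y
  uniq : ∀ (G : Type) [SeminormedAddCommGroup G] [NormedSpace ℂ G] [CompleteSpace G] [T2Space G]
    (f g : Q →L[ℂ] G), (∀ x y, f (q x y) = g (q x y)) → f = g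

/-- The canonical bilinear map into the balanced tensor product. -/
def qmap {φ : E →ₗ[ℂ] F →ₗ[ℂ] T} (h : IsProjTensor E F T φ) (r : E → C → E) (l : C → F → F) :
    E →L[ℂ] F →L[ℂ] (T ⧸ balancer φ r l) :=
  LinearMap.mkContinuous₂ (φ.compr₂ (Submodule.mkQ (balancer φ r l))) 1 (by
    intro x y
    refine (Submodule.Quotient.norm_mk_le _ _).trans ?_
    have h1 := h.isometry (x ⊗ₜ y)
    have h2 := projNorm_le (n := 1) (fun _ => x) (fun _ => y)
    simp at h1 h2
    rw [h1]; simpa using h2)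

theorem qmap_apply {φ : E →ₗ[ℂ] F →ₗ[ℂ] T} (h : IsProjTensor E F T φ) (r : E → C → E)
    (l : C → F → F) (x : E) (y : F) :
    qmap h r l x y = Submodule.Quotient.mk (φ x y) := rfl

instance balancer_closed (φ : E →ₗ[ℂ] F →ₗ[ℂ] T) (r : E → C → E) (l : C → F → F) :
    IsClosed (balancer φ r l : Set T) := Submodule.isClosed_topologicalClosure _

theorem isBal_quot {φ : E →ₗ[ℂ] F →ₗ[ℂ] T} (h : IsProjTensor E F T φ) (r : E → C → E)
    (l : C → F → F) : IsBal r l (qmap h r l) where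
  bal x c y := by
    rw [qmap_apply, qmap_apply]
    refine (Submodule.Quotient.eq _).2 ?_
    exact Submodule.le_topologicalClosure _ (Submodule.subset_span ⟨x, c, y, rfl⟩)
  univ G _ _ _ _ B hB := by
    letI : NormedAddCommGroup G := NormedAddCommGroup.ofSeparation fun x hx => by
      exact (Metric.inseparable_iff.2 (by simpa using hx : dist x 0 = 0)).eq
    let f : T →L[ℂ] G := LinearMap.extendOfNorm (TensorProduct.lift B.toLinearMap₁₂)
      (TensorProduct.lift φ)
    have hf : ∀ x y, f (φ x y) = B x y := by
      intro x y
      have := LinearMap.extendOfNorm_eq (f := TensorProduct.lift B.toLinearMap₁₂) h.dense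
        ⟨‖B‖ + 1, fun z => by rw [h.isometry]; exact norm_lift_le B z⟩ (x ⊗ₜ y)
      simpa using this
    refine ⟨(balancer φ r l).liftQL f ?_, fun x y => hf x y⟩
    refine Submodule.topologicalClosure_minimal _ (Submodule.span_le.2 ?_) ?_
    · rintro _ ⟨x, c, y, rfl⟩
      simp [hf, hB]
    · exact f.isClosed_ker
  uniq G _ _ _ _ f g hfg := by
    have key : f.comp (balancer φ r l).mkQL = g.comp (balancer φ r l).mkQL := by
      apply ContinuousLinearMap.coeFn_injective
      refine h.dense.equalizer (ContinuousLinearMap.continuous _)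
        (ContinuousLinearMap.continuous _) ?_
      ext z
      induction z using TensorProduct.induction_on with
      | zero => simp
      | tmul x y => simpa [qmap_apply] using hfg x y
      | add z w hz hw =>
        simp only [Function.comp_apply, map_add] at hz hw ⊢
        rw [hz, hw]
    ext z
    obtain ⟨t, rfl⟩ := Submodule.Quotient.mk_surjective _ z
    exact congrArg (fun k : T →L[ℂ] G => k t) key

variable {Q' : Type} [SeminormedAddCommGroup Q'] [NormedSpace ℂ Q']

theorem IsBal.flip {r : E → C → E} {l : C → F → F} {q : E →L[ℂ] F →L[ℂ] Q} (h : IsBal r l q) :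
    IsBal (fun y c => l c y) (fun c x => r x c) q.flip where
  bal x c y := (h.bal y c x).symm
  univ G _ _ _ _ B hB := by
    obtain ⟨f, hf⟩ := h.univ G B.flip (fun x c y => (hB y c x).symm)
    exact ⟨f, fun x y => hf y x⟩
  uniq G _ _ _ _ f g hfg := h.uniq G f g fun x y => hfg y x

theorem IsBal.transport {r : E → C → E} {l : C → F → F} {q : E →L[ℂ] F →L[ℂ] Q}
    {q' : E →L[ℂ] F →L[ℂ] Q'} (h : IsBal r l q) (e : Q ≃L[ℂ] Q')
    (he : ∀ x y, e (q x y) = q' x y) : IsBal r l q' where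
  bal x c y := by rw [← he, ← he, h.bal]
  univ G _ _ _ _ B hB := by
    obtain ⟨f, hf⟩ := h.univ G B hB
    exact ⟨f.comp (e.symm : Q' →L[ℂ] Q), fun x y => by simp [← he, hf]⟩
  uniq G _ _ _ _ f g hfg := by
    have := h.uniq G (f.comp (e : Q →L[ℂ] Q')) (g.comp (e : Q →L[ℂ] Q'))
      (fun x y => by simpa [he] using hfg x y)
    ext z
    have h2 := congrArg (fun k : Q →L[ℂ] G => k (e.symm z)) this
    simpa using h2

theorem IsBal.equiv [CompleteSpace Q] [T2Space Q] [CompleteSpace Q'] [T2Space Q']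
    {r : E → C → E} {l : C → F → F} {q : E →L[ℂ] F →L[ℂ] Q}
    {q' : E →L[ℂ] F →L[ℂ] Q'} (h : IsBal r l q) (h' : IsBal r l q') :
    ∃ e : Q ≃L[ℂ] Q', ∀ x y, e (q x y) = q' x y := by
  obtain ⟨f, hf⟩ := h.univ Q' q' h'.bal
  obtain ⟨g, hg⟩ := h'.univ Q q h.bal
  have h1 := h.uniq Q (g.comp f) (ContinuousLinearMap.id ℂ Q) (fun x y => by simp [hf, hg])
  have h2 := h'.uniq Q' (f.comp g) (ContinuousLinearMap.id ℂ Q') (fun x y => by simp [hf, hg])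
  exact ⟨ContinuousLinearEquiv.equivOfInverse f g
    (fun x => congrArg (fun k : Q →L[ℂ] Q => k x) h1)
    (fun x => congrArg (fun k : Q' →L[ℂ] Q' => k x) h2), fun x y => hf x y⟩

variable {A : Type} [SeminormedAddCommGroup A] [NormedSpace ℂ A]

/-- If `E` is left induced, then so is `E ⊗ F`. -/
theorem IsBal.induced [SeminormedAddCommGroup C] [NormedSpace ℂ C] [CompleteSpace Q] [T2Space Q]
    {mulA : A →L[ℂ] A →L[ℂ] A} {lE : A →L[ℂ] E →L[ℂ] E}
    (hE : IsBal (fun a b => mulA a b) (fun a x => lE a x) lE)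
    {r : E →L[ℂ] C →L[ℂ] E} {l : C → F → F} {q : E →L[ℂ] F →L[ℂ] Q}
    (hQ : IsBal (fun x c => r x c) l q)
    (hcomm : ∀ a x c, r (lE a x) c = lE a (r x c))
    {lQ : A →L[ℂ] Q →L[ℂ] Q} (hlQ : ∀ a x f, lQ a (q x f) = q (lE a x) f) :
    IsBal (fun a b => mulA a b) (fun a x => lQ a x) lQ where
  bal a b z := by
    have := hQ.uniq Q (lQ (mulA a b)) ((lQ a).comp (lQ b)) (fun x y => by
      simp only [ContinuousLinearMap.comp_apply, hlQ]
      rw [hE.bal a b x])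
    exact congrArg (fun k : Q →L[ℂ] Q => k z) this
  univ G _ _ _ _ B hB := by
    let B1 : A →L[ℂ] E →L[ℂ] (F →L[ℂ] G) :=
      ((ContinuousLinearMap.compL ℂ E (F →L[ℂ] Q) (F →L[ℂ] G)).flip q).comp
        ((ContinuousLinearMap.compL ℂ F Q G).comp B)
    have hB1 : ∀ a x f, B1 a x f = B a (q x f) := fun a x f => rfl
    obtain ⟨k, hk⟩ := hE.univ (F →L[ℂ] G) B1 (fun a b x => by
      ext f
      rw [hB1, hB1, hB, hlQ])
    have hk' : ∀ a x f, k (lE a x) f = B a (q x f) := fun a x f => by rw [hk, hB1]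
    obtain ⟨m, hm⟩ := hQ.univ G k (fun x c y => by
      have := hE.uniq G ((k.flip y).comp (r.flip c)) (k.flip (l c y)) (fun a x => by
        simp only [ContinuousLinearMap.comp_apply, ContinuousLinearMap.flip_apply]
        rw [hcomm, hk', hk', hQ.bal])
      exact congrArg (fun k : E →L[ℂ] G => k x) this)
    refine ⟨m, fun a z => ?_⟩
    have := hQ.uniq G (m.comp (lQ a)) (B a) (fun x y => by
      simp only [ContinuousLinearMap.comp_apply]
      rw [hlQ, hm, hk'])
    exact congrArg (fun k : Q →L[ℂ] G => k z) this
  uniq G _ _ _ _ f g hfg := by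
    refine hQ.uniq G f g fun x y => ?_
    have := hE.uniq G (f.comp (q.flip y)) (g.comp (q.flip y)) (fun a x => by
      simp only [ContinuousLinearMap.comp_apply, ContinuousLinearMap.flip_apply]
      rw [← hlQ, hfg])
    exact congrArg (fun k : E →L[ℂ] G => k x) this

theorem LeftInduced.isBal {mulA : A →L[ℂ] A →L[ℂ] A} {l : A →L[ℂ] E →L[ℂ] E}
    (h : LeftInduced mulA l) : IsBal (fun a b => mulA a b) (fun a x => l a x) l := by
  obtain ⟨T, _, _, φ, hT⟩ := exists_projTensor A E
  obtain ⟨e, he⟩ := h T φ hT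
  exact (isBal_quot hT _ _).transport e he

theorem RightInduced.isBal {mulA : A →L[ℂ] A →L[ℂ] A} {r : E →L[ℂ] A →L[ℂ] E}
    (h : RightInduced mulA r) : IsBal (fun x a => r x a) (fun a b => mulA a b) r := by
  obtain ⟨T, _, _, φ, hT⟩ := exists_projTensor E A
  obtain ⟨e, he⟩ := h T φ hT
  exact (isBal_quot hT _ _).transport e he

theorem SelfInduced.isBal {mulA : A →L[ℂ] A →L[ℂ] A}
    (h : SelfInduced mulA) : IsBal (fun a b => mulA a b) (fun a b => mulA a b) mulA := by
  obtain ⟨T, _, _, φ, hT⟩ := exists_projTensor A A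
  obtain ⟨e, he, -⟩ := h T φ hT
  exact (isBal_quot hT _ _).transport e he

theorem IsBal.leftInduced [CompleteSpace E] [T2Space E]
    {mulA : A →L[ℂ] A →L[ℂ] A} {l : A →L[ℂ] E →L[ℂ] E}
    (h : IsBal (fun a b => mulA a b) (fun a x => l a x) l) : LeftInduced mulA l := by
  intro T _ _ φ hT
  have := hT.complete
  exact (isBal_quot hT _ _).equiv h

theorem IsBal.rightInduced [CompleteSpace E] [T2Space E]
    {mulA : A →L[ℂ] A →L[ℂ] A} {r : E →L[ℂ] A →L[ℂ] E}
    (h : IsBal (fun x a => r x a) (fun a b => mulA a b) r) : RightInduced mulA r := by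
  intro T _ _ φ hT
  have := hT.complete
  exact (isBal_quot hT _ _).equiv h

end Helpers

theorem part_two_abs {A : Type}
    [NormedAddCommGroup A] [NormedSpace ℂ A] [CompleteSpace A]
    (mulA : A →L[ℂ] A →L[ℂ] A)
    {E : Type} [NormedAddCommGroup E] [NormedSpace ℂ E] [CompleteSpace E]
    (lE : A →L[ℂ] E →L[ℂ] E) (rE : E →L[ℂ] A →L[ℂ] E)
    (hE : IsBimoduleLaw mulA mulA lE rE)
    (hl : LeftInduced mulA lE) (hr : RightInduced mulA rE)
    {X Z : Type} [SeminormedAddCommGroup X] [NormedSpace ℂ X] [CompleteSpace X] [T2Space X]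
    [SeminormedAddCommGroup Z] [NormedSpace ℂ Z] [CompleteSpace Z] [T2Space Z]
    (qX : A →L[ℂ] E →L[ℂ] X) (qZ : X →L[ℂ] A →L[ℂ] Z)
    (lX : A →L[ℂ] X →L[ℂ] X) (rX : X →L[ℂ] A →L[ℂ] X)
    (lZ : A →L[ℂ] Z →L[ℂ] Z) (rZ : Z →L[ℂ] A →L[ℂ] Z)
    (bX : IsBal (fun a b => mulA a b) (fun a x => lE a x) qX)
    (bZ : IsBal (fun x a => rX x a) (fun a b => mulA a b) qZ)
    (hlX : ∀ a b f, lX a (qX b f) = qX (mulA a b) f)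
    (hrX : ∀ b f a, rX (qX b f) a = qX b (rE f a))
    (hlZ : ∀ a x b, lZ a (qZ x b) = qZ (lX a x) b)
    (hrZ : ∀ x b a, rZ (qZ x b) a = qZ x (mulA b a)) :
    ∃ e : Z ≃L[ℂ] E, (∀ a z, e (lZ a z) = lE a (e z)) ∧ (∀ z a, e (rZ z a) = rE (e z) a) := by
    have bE := hr.isBal
    obtain ⟨e1, he1⟩ := bX.equiv hl.isBal
    -- `e1` is a bimodule map
    have e1l : ∀ a x, e1 (lX a x) = lE a (e1 x) := by
      intro a x
      have := bX.uniq _ ((e1 : _ →L[ℂ] E).comp (lX a)) ((lE a).comp (e1 : _ →L[ℂ] E))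
        (fun b f => by
          simp only [ContinuousLinearMap.comp_apply, ContinuousLinearEquiv.coe_coe]
          rw [he1, hlX, he1, hE.1])
      exact DFunLike.congr_fun this x
    have e1r : ∀ x a, e1 (rX x a) = rE (e1 x) a := by
      intro x a
      have := bX.uniq _ ((e1 : _ →L[ℂ] E).comp (rX.flip a)) ((rE.flip a).comp (e1 : _ →L[ℂ] E))
        (fun b f => by
          simp only [ContinuousLinearMap.comp_apply, ContinuousLinearEquiv.coe_coe,
            ContinuousLinearMap.flip_apply]
          rw [he1, hrX, he1, hE.2.2])
      exact DFunLike.congr_fun this x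
    -- transport `E ⊗ A = E` to `X ⊗ A = E`
    have bE' : IsBal (fun x a => rX x a) (fun a b => mulA a b)
        (rE.comp (e1 : _ →L[ℂ] E)) := by
      refine ⟨fun x c y => ?_, ?_, ?_⟩
      · simp only [ContinuousLinearMap.comp_apply, ContinuousLinearEquiv.coe_coe]
        rw [e1r, hE.2.1]
      · intro G _ _ _ _ B hB
        obtain ⟨f, hf⟩ := bE.univ G (B.comp (e1.symm : E →L[ℂ] _)) (fun x c y => by
          simp only [ContinuousLinearMap.comp_apply, ContinuousLinearEquiv.coe_coe]
          rw [← hB]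
          congr 2
          rw [e1.symm_apply_eq, e1r, e1.apply_symm_apply])
        exact ⟨f, fun x y => by
          simp only [ContinuousLinearMap.comp_apply, ContinuousLinearEquiv.coe_coe]
          rw [hf]; simp⟩
      · intro G _ _ _ _ f g hfg
        refine bE.uniq G f g fun x y => ?_
        simpa using hfg (e1.symm x) y
    obtain ⟨e, he⟩ := bZ.equiv bE'
    refine ⟨e, fun a z => ?_, fun z a => ?_⟩
    · have := bZ.uniq _ ((e : _ →L[ℂ] E).comp (lZ a)) ((lE a).comp (e : _ →L[ℂ] E))
        (fun x b => by
          simp only [ContinuousLinearMap.comp_apply, ContinuousLinearEquiv.coe_coe]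
          rw [he, hlZ, he]
          simp only [ContinuousLinearMap.comp_apply, ContinuousLinearEquiv.coe_coe]
          rw [e1l, hE.2.2])
      exact DFunLike.congr_fun this z
    · have := bZ.uniq _ ((e : _ →L[ℂ] E).comp (rZ.flip a)) ((rE.flip a).comp (e : _ →L[ℂ] E))
        (fun x b => by
          simp only [ContinuousLinearMap.comp_apply, ContinuousLinearEquiv.coe_coe,
            ContinuousLinearMap.flip_apply]
          rw [he, hrZ, he]
          simp only [ContinuousLinearMap.comp_apply, ContinuousLinearEquiv.coe_coe]
          rw [hE.2.1])
      exact DFunLike.congr_fun this z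

set_option maxHeartbeats 2000000 in
theorem part_two (A : Type)
    [NormedAddCommGroup A] [NormedSpace ℂ A] [CompleteSpace A]
    (mulA : A →L[ℂ] A →L[ℂ] A)
    (E : Type) [NormedAddCommGroup E] [NormedSpace ℂ E] [CompleteSpace E]
      (lE : A →L[ℂ] E →L[ℂ] E) (rE : E →L[ℂ] A →L[ℂ] E)
      (hE : IsBimoduleLaw mulA mulA lE rE)
      (hl : LeftInduced mulA lE) (hr : RightInduced mulA rE) :
        ∀ (T1 : Type) [NormedAddCommGroup T1] [NormedSpace ℂ T1]
          (φ1 : A →ₗ[ℂ] E →ₗ[ℂ] T1), IsProjTensor A E T1 φ1 →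
          ∀ (lX : A →L[ℂ]
                (T1 ⧸ balancer φ1 (fun a b => mulA a b) (fun a y => lE a y)) →L[ℂ]
                (T1 ⧸ balancer φ1 (fun a b => mulA a b) (fun a y => lE a y)))
            (rX : (T1 ⧸ balancer φ1 (fun a b => mulA a b) (fun a y => lE a y)) →L[ℂ]
                A →L[ℂ]
                (T1 ⧸ balancer φ1 (fun a b => mulA a b) (fun a y => lE a y))),
            (∀ (a b : A) (f : E),
              lX a (Submodule.Quotient.mk (φ1 b f))
                = Submodule.Quotient.mk (φ1 (mulA a b) f)) →
            (∀ (b : A) (f : E) (a : A),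
              rX (Submodule.Quotient.mk (φ1 b f)) a
                = Submodule.Quotient.mk (φ1 b (rE f a))) →
            ∀ (T2 : Type) [NormedAddCommGroup T2] [NormedSpace ℂ T2]
              (φ2 : (T1 ⧸ balancer φ1 (fun a b => mulA a b) (fun a y => lE a y)) →ₗ[ℂ]
                  A →ₗ[ℂ] T2),
              IsProjTensor (T1 ⧸ balancer φ1 (fun a b => mulA a b) (fun a y => lE a y))
                A T2 φ2 →
              ∀ (lZ : A →L[ℂ]
                    (T2 ⧸ balancer φ2 (fun x a => rX x a) (fun a b => mulA a b)) →L[ℂ]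
                    (T2 ⧸ balancer φ2 (fun x a => rX x a) (fun a b => mulA a b)))
                (rZ : (T2 ⧸ balancer φ2 (fun x a => rX x a) (fun a b => mulA a b)) →L[ℂ]
                    A →L[ℂ]
                    (T2 ⧸ balancer φ2 (fun x a => rX x a) (fun a b => mulA a b))),
                (∀ (a : A)
                  (x : T1 ⧸ balancer φ1 (fun a b => mulA a b) (fun a y => lE a y))
                  (b : A),
                  lZ a (Submodule.Quotient.mk (φ2 x b))
                    = Submodule.Quotient.mk (φ2 (lX a x) b)) →
                (∀ (x : T1 ⧸ balancer φ1 (fun a b => mulA a b) (fun a y => lE a y))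
                  (b a : A),
                  rZ (Submodule.Quotient.mk (φ2 x b)) a
                    = Submodule.Quotient.mk (φ2 x (mulA b a))) →
                ∃ e : (T2 ⧸ balancer φ2 (fun x a => rX x a) (fun a b => mulA a b)) ≃L[ℂ] E,
                  (∀ (a : A) (z : T2 ⧸ balancer φ2 (fun x a => rX x a) (fun a b => mulA a b)),
                    e (lZ a z) = lE a (e z)) ∧
                  (∀ (z : T2 ⧸ balancer φ2 (fun x a => rX x a) (fun a b => mulA a b)) (a : A),
                    e (rZ z a) = rE (e z) a) := by
    intro T1 _ _ φ1 h1 lX rX hlX hrX T2 _ _ φ2 h2 lZ rZ hlZ hrZ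
    have := h1.complete
    have := h2.complete
    exact part_two_abs mulA lE rE hE hl hr _ _ lX rX lZ rZ (isBal_quot h1 _ _) (isBal_quot h2 _ _)
      hlX hrX hlZ hrZ

set_option maxHeartbeats 2000000 in
/-- Let `A` be a self-induced Banach algebra.  For every Banach
`A`-bimodule `F`, the bimodule `A ⊗̂_A F ⊗̂_A A` is two-sided `A`-induced; moreover
every two-sided `A`-induced Banach `A`-bimodule is isomorphic to one of this form.
Here `A ⊗̂_A F` is realized as the quotient of a realization `T1` of `A ⊗̂ F` by the
closed span of the balancing relations, and `(A ⊗̂_A F) ⊗̂_A A` as the corresponding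
quotient of a realization `T2`. -/
theorem brandt_morita_stmt18 (A : Type)
    [NormedAddCommGroup A] [NormedSpace ℂ A] [CompleteSpace A]
    (mulA : A →L[ℂ] A →L[ℂ] A)
    (hassoc : ∀ a b c : A, mulA (mulA a b) c = mulA a (mulA b c))
    (hself : SelfInduced mulA) :
    -- (1) `A ⊗̂_A F ⊗̂_A A` is two-sided `A`-induced
    (∀ (F : Type) [NormedAddCommGroup F] [NormedSpace ℂ F] [CompleteSpace F]
      (lF : A →L[ℂ] F →L[ℂ] F) (rF : F →L[ℂ] A →L[ℂ] F),
      IsBimoduleLaw mulA mulA lF rF →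
      ∀ (T1 : Type) [NormedAddCommGroup T1] [NormedSpace ℂ T1]
        (φ1 : A →ₗ[ℂ] F →ₗ[ℂ] T1), IsProjTensor A F T1 φ1 →
        -- the induced bimodule actions on `X = A ⊗̂_A F`
        ∀ (lX : A →L[ℂ]
              (T1 ⧸ balancer φ1 (fun a b => mulA a b) (fun a y => lF a y)) →L[ℂ]
              (T1 ⧸ balancer φ1 (fun a b => mulA a b) (fun a y => lF a y)))
          (rX : (T1 ⧸ balancer φ1 (fun a b => mulA a b) (fun a y => lF a y)) →L[ℂ]
              A →L[ℂ]
              (T1 ⧸ balancer φ1 (fun a b => mulA a b) (fun a y => lF a y))),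
          (∀ (a b : A) (f : F),
            lX a (Submodule.Quotient.mk (φ1 b f))
              = Submodule.Quotient.mk (φ1 (mulA a b) f)) →
          (∀ (b : A) (f : F) (a : A),
            rX (Submodule.Quotient.mk (φ1 b f)) a
              = Submodule.Quotient.mk (φ1 b (rF f a))) →
          ∀ (T2 : Type) [NormedAddCommGroup T2] [NormedSpace ℂ T2]
            (φ2 : (T1 ⧸ balancer φ1 (fun a b => mulA a b) (fun a y => lF a y)) →ₗ[ℂ]
                A →ₗ[ℂ] T2),
            IsProjTensor (T1 ⧸ balancer φ1 (fun a b => mulA a b) (fun a y => lF a y))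
              A T2 φ2 →
            -- the induced bimodule actions on `Z = X ⊗̂_A A`
            ∀ (lZ : A →L[ℂ]
                  (T2 ⧸ balancer φ2 (fun x a => rX x a) (fun a b => mulA a b)) →L[ℂ]
                  (T2 ⧸ balancer φ2 (fun x a => rX x a) (fun a b => mulA a b)))
              (rZ : (T2 ⧸ balancer φ2 (fun x a => rX x a) (fun a b => mulA a b)) →L[ℂ]
                  A →L[ℂ]
                  (T2 ⧸ balancer φ2 (fun x a => rX x a) (fun a b => mulA a b))),
              (∀ (a : A) (x : T1 ⧸ balancer φ1 (fun a b => mulA a b) (fun a y => lF a y))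
                (b : A),
                lZ a (Submodule.Quotient.mk (φ2 x b))
                  = Submodule.Quotient.mk (φ2 (lX a x) b)) →
              (∀ (x : T1 ⧸ balancer φ1 (fun a b => mulA a b) (fun a y => lF a y))
                (b a : A),
                rZ (Submodule.Quotient.mk (φ2 x b)) a
                  = Submodule.Quotient.mk (φ2 x (mulA b a))) →
              LeftInduced mulA lZ ∧ RightInduced mulA rZ) ∧
    -- (2) every two-sided `A`-induced Banach `A`-bimodule is of this form
    (∀ (E : Type) [NormedAddCommGroup E] [NormedSpace ℂ E] [CompleteSpace E]
      (lE : A →L[ℂ] E →L[ℂ] E) (rE : E →L[ℂ] A →L[ℂ] E),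
      IsBimoduleLaw mulA mulA lE rE →
      LeftInduced mulA lE → RightInduced mulA rE →
      ∃ W : BimodOver A mulA,
        ∀ (T1 : Type) [NormedAddCommGroup T1] [NormedSpace ℂ T1]
          (φ1 : A →ₗ[ℂ] W.E →ₗ[ℂ] T1), IsProjTensor A W.E T1 φ1 →
          ∀ (lX : A →L[ℂ]
                (T1 ⧸ balancer φ1 (fun a b => mulA a b) (fun a y => W.l a y)) →L[ℂ]
                (T1 ⧸ balancer φ1 (fun a b => mulA a b) (fun a y => W.l a y)))
            (rX : (T1 ⧸ balancer φ1 (fun a b => mulA a b) (fun a y => W.l a y)) →L[ℂ]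
                A →L[ℂ]
                (T1 ⧸ balancer φ1 (fun a b => mulA a b) (fun a y => W.l a y))),
            (∀ (a b : A) (f : W.E),
              lX a (Submodule.Quotient.mk (φ1 b f))
                = Submodule.Quotient.mk (φ1 (mulA a b) f)) →
            (∀ (b : A) (f : W.E) (a : A),
              rX (Submodule.Quotient.mk (φ1 b f)) a
                = Submodule.Quotient.mk (φ1 b (W.r f a))) →
            ∀ (T2 : Type) [NormedAddCommGroup T2] [NormedSpace ℂ T2]
              (φ2 : (T1 ⧸ balancer φ1 (fun a b => mulA a b) (fun a y => W.l a y)) →ₗ[ℂ]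
                  A →ₗ[ℂ] T2),
              IsProjTensor (T1 ⧸ balancer φ1 (fun a b => mulA a b) (fun a y => W.l a y))
                A T2 φ2 →
              ∀ (lZ : A →L[ℂ]
                    (T2 ⧸ balancer φ2 (fun x a => rX x a) (fun a b => mulA a b)) →L[ℂ]
                    (T2 ⧸ balancer φ2 (fun x a => rX x a) (fun a b => mulA a b)))
                (rZ : (T2 ⧸ balancer φ2 (fun x a => rX x a) (fun a b => mulA a b)) →L[ℂ]
                    A →L[ℂ]
                    (T2 ⧸ balancer φ2 (fun x a => rX x a) (fun a b => mulA a b))),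
                (∀ (a : A)
                  (x : T1 ⧸ balancer φ1 (fun a b => mulA a b) (fun a y => W.l a y))
                  (b : A),
                  lZ a (Submodule.Quotient.mk (φ2 x b))
                    = Submodule.Quotient.mk (φ2 (lX a x) b)) →
                (∀ (x : T1 ⧸ balancer φ1 (fun a b => mulA a b) (fun a y => W.l a y))
                  (b a : A),
                  rZ (Submodule.Quotient.mk (φ2 x b)) a
                    = Submodule.Quotient.mk (φ2 x (mulA b a))) →
                ∃ e : (T2 ⧸ balancer φ2 (fun x a => rX x a) (fun a b => mulA a b)) ≃L[ℂ] E,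
                  (∀ (a : A) (z : T2 ⧸ balancer φ2 (fun x a => rX x a) (fun a b => mulA a b)),
                    e (lZ a z) = lE a (e z)) ∧
                  (∀ (z : T2 ⧸ balancer φ2 (fun x a => rX x a) (fun a b => mulA a b)) (a : A),
                    e (rZ z a) = rE (e z) a)) := by
  refine ⟨?_, ?_⟩
  · intro F _ _ _ lF rF hF T1 _ _ φ1 h1 lX rX hlX hrX T2 _ _ φ2 h2 lZ rZ hlZ hrZ
    have := h1.complete
    have := h2.complete
    have bA := hself.isBal
    have bX := isBal_quot h1 (fun a b => mulA a b) (fun a y => lF a y)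
    have bZ := isBal_quot h2 (fun x a => rX x a) (fun a b => mulA a b)
    have bX' := bA.induced (r := mulA) bX hassoc (lQ := lX) (fun a x f => hlX a x f)
    have hcomm : ∀ a x c, rX (lX a x) c = lX a (rX x c) := by
      intro a x c
      have := bX.uniq _ ((rX.flip c).comp (lX a)) ((lX a).comp (rX.flip c)) (fun b f => by
        simp only [ContinuousLinearMap.comp_apply, ContinuousLinearMap.flip_apply, qmap_apply]
        rw [hlX, hrX, hrX, hlX])
      exact DFunLike.congr_fun this x
    refine ⟨(bX'.induced bZ hcomm (lQ := lZ) (fun a x f => hlZ a x f)).leftInduced, ?_⟩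
    have bA' : IsBal (fun a b => mulA.flip a b) (fun a b => mulA.flip a b) mulA.flip := bA.flip
    have bR := bA'.induced (r := mulA.flip) bZ.flip (fun a x c => (hassoc c x a).symm)
      (lQ := rZ.flip) (fun a x f => hrZ f x a)
    exact IsBal.rightInduced bR.flip
  · intro E _ _ _ lE rE hE hl hr
    exact ⟨⟨E, lE, rE, hE⟩, part_two A mulA E lE rE hE hl hr⟩
end
end
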